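/- Under the (f,Γ)-GAN assumptions (see context), for every ε > 0: ℙ( D_f^Γ(Q‖P_{θ*_{n,m}}) − inf_{θ∈Θ} D_f^Γ(Q‖P_θ) ≥ ε + ε_{approx}^{Γ,Γ̃} + ε^{opt}_{n,m} + 4 R_{Γ̃,Q,n} + 4 K_{f,Γ̃∘Φ,P_Z,m} ) ≤ exp( −ε² / ( (2/n)(β−α)² + (2/m) Δ_{f,m}² ) ). -/

import Mathlib

open MeasureTheory Set Filter Topology
open scoped ENNReal NNReal Classical

noncomputable section

/-- The interval `(a, b)` with `b` possibly infinite. -/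
def Dom (a : ℝ) (b : EReal) : Set ℝ := {t : ℝ | a < t ∧ (t : EReal) < b}

/-- Legendre transform of `f` on `(a,b)`, with values in `(-∞, ∞]` (modeled by `EReal`). -/
def fStar (f : ℝ → ℝ) (a : ℝ) (b : EReal) (z : ℝ) : EReal :=
  ⨆ t ∈ Dom a b, ((z * t - f t : ℝ) : EReal)

/-- Real-valued version of the Legendre transform (junk value where it is `⊤`). -/
def fStarR (f : ℝ → ℝ) (a : ℝ) (b : EReal) (z : ℝ) : ℝ := (fStar f a b z).toReal

/-- Right derivative of `g` at `z`. -/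
def rderiv (g : ℝ → ℝ) (z : ℝ) : ℝ := derivWithin g (Ici z) z

/-- `z₀ := f'_+(1)`. -/
def zz (f : ℝ → ℝ) : ℝ := rderiv f 1

/-- Integral of an `EReal`-valued function: the Bochner integral if the function is
a.e. finite and integrable, and `⊤` otherwise. -/
def eIntegral {X : Type*} [MeasurableSpace X] (P : Measure X) (g : X → EReal) : EReal :=
  if (∀ᵐ x ∂P, g x ≠ ⊤) ∧ Integrable (fun x => (g x).toReal) P
  then ((∫ x, (g x).toReal ∂P : ℝ) : EReal) else ⊤

/-- The generalized cumulant generating function `Λ_f^P[h]`. -/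
def cgf {X : Type*} [MeasurableSpace X] (f : ℝ → ℝ) (a : ℝ) (b : EReal)
    (P : Measure X) (h : X → ℝ) : EReal :=
  ⨅ ν : ℝ, ((ν : EReal) + eIntegral P (fun x => fStar f a b (h x - ν)))

/-- Real-valued `Λ_f^P[h]`. -/
def cgfR {X : Type*} [MeasurableSpace X] (f : ℝ → ℝ) (a : ℝ) (b : EReal)
    (P : Measure X) (h : X → ℝ) : ℝ := (cgf f a b P h).toReal

/-- `Λ_f : ℝⁿ → ℝ` (with values in `EReal`). -/
def lamVec (f : ℝ → ℝ) (a : ℝ) (b : EReal) {n : ℕ} (x : Fin n → ℝ) : EReal :=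
  ⨅ ν : ℝ, ((ν : EReal) + ((n : ℝ)⁻¹ : EReal) * ∑ i, fStar f a b (x i - ν))

/-- Empirical measure of `n` points. -/
def empMeas {X : Type*} [MeasurableSpace X] (n : ℕ) (xs : Fin n → X) : Measure X :=
  (n : ℝ≥0∞)⁻¹ • ∑ i, Measure.dirac (xs i)

/-- The `(f,Γ)`-divergence `D_f^Γ(Q‖P)`. -/
def Dfg {X : Type*} [MeasurableSpace X] (f : ℝ → ℝ) (a : ℝ) (b : EReal)
    (Γ : Set (X → ℝ)) (Q P : Measure X) : ℝ :=
  sSup {r : ℝ | ∃ h ∈ Γ, r = ∫ x, h x ∂Q - cgfR f a b P h}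

/-- Empirical Rademacher complexity of `Ψ` at the sample `y`. -/
def empRad {Y : Type*} (Ψ : Set (Y → ℝ)) (n : ℕ) (y : Fin n → Y) : ℝ :=
  (2 ^ n : ℝ)⁻¹ * ∑ σ : Fin n → Bool,
    sSup {r : ℝ | ∃ ψ ∈ Ψ, r = (n : ℝ)⁻¹ * ∑ i, (if σ i then 1 else -1) * ψ (y i)}

/-- Rademacher complexity of `Ψ` relative to `P` with `n` samples. -/
def rad {Y : Type*} [MeasurableSpace Y] (Ψ : Set (Y → ℝ)) (P : Measure Y) (n : ℕ) : ℝ :=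
  ∫ y, empRad Ψ n y ∂(Measure.pi fun _ : Fin n => P)

/-- `Δ_{f,n}`. -/
def Δq (f : ℝ → ℝ) (a : ℝ) (b : EReal) (α β : ℝ) (n : ℕ) : ℝ :=
  sInf ((fun z => (n : ℝ) * (-z + (((n : ℝ) - 1) / (n : ℝ)) * fStarR f a b z
      + (1 / (n : ℝ)) * fStarR f a b (β - α + z))) '' Icc (zz f - (β - α)) (zz f))

/-- `sup_{h ∈ Γ} inf_{h̃ ∈ Γ̃} ‖h − h̃‖_∞`. -/
def approxErr {X : Type*} (Γ Γt : Set (X → ℝ)) : ℝ :=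
  sSup {r : ℝ | ∃ h ∈ Γ, r = sInf {s : ℝ | ∃ ht ∈ Γt, s = ⨆ x, |h x - ht x|}}

/-- A countable subset which is pointwise-limit dense. -/
def PtwiseDenseCount {X : Type*} (Γ : Set (X → ℝ)) : Prop :=
  ∃ Γ₀ ⊆ Γ, Γ₀.Countable ∧ ∀ h ∈ Γ, ∃ s : ℕ → X → ℝ,
    (∀ j, s j ∈ Γ₀) ∧ ∀ x, Tendsto (fun j => s j x) atTop (𝓝 (h x))

/-- The quantity `K_{f,Ψ,P,n}` from Definition 3.4: either `(f*)'_+` is Lipschitz on the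
relevant interval and `Ψ` contains a constant, in which case `K` is the minimum of the two
expressions, or `K` is the second expression. -/
def Kchoice (f : ℝ → ℝ) (a : ℝ) (b : EReal) (α β : ℝ) {Y : Type*} [MeasurableSpace Y]
    (Ψ : Set (Y → ℝ)) (P : Measure Y) (n : ℕ) (K : ℝ) : Prop :=
  (∃ L : ℝ≥0, LipschitzOnWith L (rderiv (fStarR f a b))
      (Icc (zz f - (β - α)) (zz f + (β - α))) ∧
    (∃ c : ℝ, (fun _ => c) ∈ Ψ) ∧
    K = min ((1 + 2 * (β - α) * (L : ℝ)) * rad Ψ P n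
        + (β - α) ^ 2 * (L : ℝ) / (2 * Real.sqrt n))
      (rderiv (fStarR f a b) (β - α + zz f) * (rad Ψ P n + (β - α) / (2 * Real.sqrt n))))
  ∨ K = rderiv (fStarR f a b) (β - α + zz f) * (rad Ψ P n + (β - α) / (2 * Real.sqrt n))

/-- Covering number of a (pseudo)metric space by `ε`-balls. -/
def coverNum (Θ : Type*) [PseudoMetricSpace Θ] (ε : ℝ) : ℝ≥0∞ :=
  ⨅ s ∈ {s : Finset Θ | ∀ θ : Θ, ∃ c ∈ s, dist θ c ≤ ε}, ((s.card : ℝ≥0∞))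

end

/-- The right derivative of a convex function at an interior point is a subgradient. -/
lemma ConvexOn.add_rderiv_mul_le {S : Set ℝ} {g : ℝ → ℝ} (hg : ConvexOn ℝ S g) {x y : ℝ}
    (hx : x ∈ interior S) (hy : y ∈ S) : g x + rderiv g x * (y - x) ≤ g y := by
  have hxS := interior_subset hx
  have hr : rderiv g x = derivWithin g (Ioi x) x := by
    rw [rderiv, derivWithin_Ioi_eq_Ici]
  rcases lt_trichotomy x y with h | h | h
  · have := hg.rightDeriv_le_slope_of_mem_interior hx hy h
    rw [← hr, slope_def_field, le_div_iff₀ (by linarith)] at this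
    linarith
  · subst h; simp
  · have h1 := hg.slope_le_leftDeriv_of_mem_interior hy hx h
    have h2 := hg.leftDeriv_le_rightDeriv_of_mem_interior hx
    have := h1.trans h2
    rw [← hr, slope_def_field, div_le_iff₀ (by linarith)] at this
    linarith

section Legendre

variable {f : ℝ → ℝ} {a : ℝ} {b : EReal}

lemma one_mem_Dom (ha1 : a < 1) (hb1 : ((1 : ℝ) : EReal) < b) : (1 : ℝ) ∈ Dom a b := ⟨ha1, hb1⟩

lemma isOpen_Dom : IsOpen (Dom a b) :=
  (isOpen_lt continuous_const continuous_id).inter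
    (isOpen_lt continuous_coe_real_ereal continuous_const)

lemma le_fStar {t : ℝ} (ht : t ∈ Dom a b) (z : ℝ) :
    ((z * t - f t : ℝ) : EReal) ≤ fStar f a b z :=
  le_iSup₂_of_le t ht le_rfl

lemma coe_le_fStar (h1 : (1 : ℝ) ∈ Dom a b) (hf1 : f 1 = 0) (z : ℝ) :
    (z : EReal) ≤ fStar f a b z := by
  simpa [hf1] using le_fStar (f := f) h1 z

lemma fStar_ne_bot (h1 : (1 : ℝ) ∈ Dom a b) (hf1 : f 1 = 0) (z : ℝ) : fStar f a b z ≠ ⊥ :=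
  fun h => by simpa [h] using coe_le_fStar h1 hf1 z

lemma coe_fStarR (h1 : (1 : ℝ) ∈ Dom a b) (hf1 : f 1 = 0) {z : ℝ} (hz : fStar f a b z ≠ ⊤) :
    ((fStarR f a b z : ℝ) : EReal) = fStar f a b z :=
  EReal.coe_toReal hz (fStar_ne_bot h1 hf1 z)

lemma fStar_mono (ha0 : 0 ≤ a) : Monotone (fStar f a b) := by
  intro x y hxy
  refine iSup₂_mono fun t ht => ?_
  have : 0 < t := ha0.trans_lt ht.1
  exact_mod_cast sub_le_sub_right (mul_le_mul_of_nonneg_right hxy this.le) _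

lemma measurable_fStar (ha0 : 0 ≤ a) : Measurable (fStar f a b) := (fStar_mono ha0).measurable

lemma measurable_fStarR (ha0 : 0 ≤ a) : Measurable (fStarR f a b) :=
  (measurable_fStar ha0).ereal_toReal

lemma fStar_ne_top_of_le (ha0 : 0 ≤ a) {x y : ℝ} (hxy : x ≤ y) (hy : fStar f a b y ≠ ⊤) :
    fStar f a b x ≠ ⊤ :=
  ((fStar_mono ha0 hxy).trans_lt (lt_top_iff_ne_top.2 hy)).ne

lemma fStar_zz (h1 : (1 : ℝ) ∈ Dom a b) (hf1 : f 1 = 0) (hconv : ConvexOn ℝ (Dom a b) f) :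
    fStar f a b (zz f) = ((zz f : ℝ) : EReal) := by
  refine le_antisymm (iSup₂_le fun t ht => ?_) (coe_le_fStar h1 hf1 _)
  have := hconv.add_rderiv_mul_le (isOpen_Dom.interior_eq.symm ▸ h1) ht
  rw [hf1, ← zz] at this
  exact_mod_cast (by linarith : zz f * t - f t ≤ zz f)

lemma convexOn_fStarR (h1 : (1 : ℝ) ∈ Dom a b) (hf1 : f 1 = 0) :
    ConvexOn ℝ {z | fStar f a b z < ⊤} (fStarR f a b) := by
  have key : ∀ ⦃x⦄, fStar f a b x < ⊤ → ∀ ⦃y⦄, fStar f a b y < ⊤ → ∀ ⦃p q : ℝ⦄, 0 ≤ p → 0 ≤ q →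
      p + q = 1 → fStar f a b (p • x + q • y) ≤
        ((p • fStarR f a b x + q • fStarR f a b y : ℝ) : EReal) := by
    intro x hx y hy p q hp hq hpq
    refine iSup₂_le fun t ht => ?_
    have hxt := le_fStar (f := f) ht x
    have hyt := le_fStar (f := f) ht y
    rw [← coe_fStarR h1 hf1 hx.ne, EReal.coe_le_coe_iff] at hxt
    rw [← coe_fStarR h1 hf1 hy.ne, EReal.coe_le_coe_iff] at hyt
    rw [EReal.coe_le_coe_iff]
    have e : (p • x + q • y) * t - f t = p * (x * t - f t) + q * (y * t - f t) := by
      have : q = 1 - p := by linarith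
      subst this
      simp only [smul_eq_mul]; ring
    rw [e, smul_eq_mul, smul_eq_mul]
    exact add_le_add (mul_le_mul_of_nonneg_left hxt hp) (mul_le_mul_of_nonneg_left hyt hq)
  refine ⟨fun x hx y hy p q hp hq hpq => (key hx hy hp hq hpq).trans_lt (EReal.coe_lt_top _),
    fun x hx y hy p q hp hq hpq => ?_⟩
  have h := key hx hy hp hq hpq
  rwa [← coe_fStarR h1 hf1 (h.trans_lt (EReal.coe_lt_top _)).ne, EReal.coe_le_coe_iff] at h

end Legendre

/-- A monotone convex function on `[z₀ - r, z₀ + r]` that lies above the identity, touches it at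
`z₀`, and is `M`-Lipschitz. -/
structure TangentConvex (φ : ℝ → ℝ) (z₀ r M : ℝ) : Prop where
  pos : 0 < r
  convex : ConvexOn ℝ (Icc (z₀ - r) (z₀ + r)) φ
  mono : MonotoneOn φ (Icc (z₀ - r) (z₀ + r))
  lip : ∀ x ∈ Icc (z₀ - r) (z₀ + r), ∀ y ∈ Icc (z₀ - r) (z₀ + r), |φ x - φ y| ≤ M * |x - y|
  le : ∀ x ∈ Icc (z₀ - r) (z₀ + r), x ≤ φ x
  eq : φ z₀ = z₀
  one_le : 1 ≤ M

section

variable {f : ℝ → ℝ} {a : ℝ} {b : EReal}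

lemma le_fStarR (h1 : (1 : ℝ) ∈ Dom a b) (hf1 : f 1 = 0) {z : ℝ} (hz : fStar f a b z ≠ ⊤) :
    z ≤ fStarR f a b z := by
  have := coe_le_fStar (f := f) h1 hf1 z
  rwa [← coe_fStarR h1 hf1 hz, EReal.coe_le_coe_iff] at this

lemma fStarR_zz (h1 : (1 : ℝ) ∈ Dom a b) (hf1 : f 1 = 0) (hconv : ConvexOn ℝ (Dom a b) f) :
    fStarR f a b (zz f) = zz f := by
  rw [fStarR, fStar_zz h1 hf1 hconv, EReal.toReal_coe]

lemma fStarR_le_fStarR (ha0 : 0 ≤ a) (h1 : (1 : ℝ) ∈ Dom a b) (hf1 : f 1 = 0) {x y : ℝ}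
    (hxy : x ≤ y) (hy : fStar f a b y ≠ ⊤) : fStarR f a b x ≤ fStarR f a b y := by
  have := fStar_mono (f := f) (b := b) ha0 hxy
  rwa [← coe_fStarR h1 hf1 hy, ← coe_fStarR h1 hf1 (fStar_ne_top_of_le ha0 hxy hy),
    EReal.coe_le_coe_iff] at this

lemma mem_interior_of_le (ha0 : 0 ≤ a) {x y : ℝ} (hxy : x ≤ y)
    (hy : y ∈ interior {z | fStar f a b z < ⊤}) : x ∈ interior {z | fStar f a b z < ⊤} := by
  rw [mem_interior_iff_mem_nhds, Metric.mem_nhds_iff] at hy ⊢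
  obtain ⟨δ, hδ, h⟩ := hy
  refine ⟨δ, hδ, fun w hw => ?_⟩
  have : w + (y - x) ∈ Metric.ball y δ := by
    rw [Metric.mem_ball, Real.dist_eq] at hw ⊢
    convert! hw using 2; ring
  exact (fStar_mono ha0 (by linarith : w ≤ w + (y - x))).trans_lt (h this)

lemma tangentConvex_fStarR (ha0 : 0 ≤ a) (h1 : (1 : ℝ) ∈ Dom a b) (hf1 : f 1 = 0)
    (hconv : ConvexOn ℝ (Dom a b) f) {r : ℝ} (hr : 0 < r)
    (hz : zz f + r ∈ interior {z : ℝ | fStar f a b z < ⊤}) :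
    TangentConvex (fStarR f a b) (zz f) r (rderiv (fStarR f a b) (zz f + r)) := by
  have hfin : fStar f a b (zz f + r) ≠ ⊤ := (interior_subset hz).ne
  have hfin' : ∀ x ∈ Icc (zz f - r) (zz f + r), fStar f a b x ≠ ⊤ :=
    fun x hx => fStar_ne_top_of_le ha0 hx.2 hfin
  have hC := convexOn_fStarR (f := f) h1 hf1
  have hzz := fStarR_zz h1 hf1 hconv
  have hone : 1 ≤ rderiv (fStarR f a b) (zz f + r) := by
    have h := hC.add_rderiv_mul_le hz (y := zz f) (lt_top_iff_ne_top.2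
      (fStar_ne_top_of_le ha0 (by linarith) hfin))
    have h' := le_fStarR h1 hf1 hfin
    rw [hzz] at h
    nlinarith
  have hlip : ∀ x y, x ≤ y → y ∈ Icc (zz f - r) (zz f + r) →
      fStarR f a b y - fStarR f a b x ≤ rderiv (fStarR f a b) (zz f + r) * (y - x) := by
    intro x y hxy hy
    rcases hxy.eq_or_lt with rfl | hlt
    · simp
    have hyI := mem_interior_of_le ha0 hy.2 hz
    have hx : x ∈ {z : ℝ | fStar f a b z < ⊤} := lt_top_iff_ne_top.2
      (fStar_ne_top_of_le ha0 (hxy.trans hy.2) hfin)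
    have e1 := hC.add_rderiv_mul_le hyI hx
    have e2 := hC.add_rderiv_mul_le hyI (interior_subset hz)
    have e3 := hC.add_rderiv_mul_le hz (interior_subset hyI)
    rcases hy.2.eq_or_lt with rfl | hlt2
    · linarith
    · have : rderiv (fStarR f a b) y ≤ rderiv (fStarR f a b) (zz f + r) := by nlinarith
      nlinarith
  refine ⟨hr, hC.subset (fun x hx => lt_top_iff_ne_top.2 (hfin' x hx)) (convex_Icc _ _),
    fun x _ y hy hxy => fStarR_le_fStarR ha0 h1 hf1 hxy (hfin' y hy), ?_,
    fun x hx => le_fStarR h1 hf1 (hfin' x hx), hzz, hone⟩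
  have key : ∀ x ∈ Icc (zz f - r) (zz f + r), ∀ y ∈ Icc (zz f - r) (zz f + r), x ≤ y →
      |fStarR f a b x - fStarR f a b y| ≤ rderiv (fStarR f a b) (zz f + r) * |x - y| := by
    intro x hx y hy hxy
    rw [abs_sub_comm, abs_sub_comm x, abs_of_nonneg (sub_nonneg.2 hxy),
      abs_of_nonneg (sub_nonneg.2 (fStarR_le_fStarR ha0 h1 hf1 hxy (hfin' y hy)))]
    exact hlip x y hxy hy
  intro x hx y hy
  rcases le_total x y with h | h
  · exact key x hx y hy h
  · rw [abs_sub_comm, abs_sub_comm x]; exact key y hy x hx h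

/-- If the right derivative of `f*` is `L`-Lipschitz near `z₀`, then `f* - id` is `L r`-Lipschitz,
because that derivative equals `1` at `z₀`. -/
lemma fStarR_sub_id_lipschitz (ha0 : 0 ≤ a) (h1 : (1 : ℝ) ∈ Dom a b) (hf1 : f 1 = 0)
    (hconv : ConvexOn ℝ (Dom a b) f) {r : ℝ} (hr : 0 < r)
    (hz : zz f + r ∈ interior {z : ℝ | fStar f a b z < ⊤}) {L : ℝ≥0}
    (hL : LipschitzOnWith L (rderiv (fStarR f a b)) (Icc (zz f - r) (zz f + r)))
    {x y : ℝ} (hx : x ∈ Icc (zz f - r) (zz f + r)) (hy : y ∈ Icc (zz f - r) (zz f + r)) :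
    |(fStarR f a b x - x) - (fStarR f a b y - y)| ≤ (L * r) * |x - y| := by
  have hC := convexOn_fStarR (f := f) h1 hf1
  have hI : ∀ x ∈ Icc (zz f - r) (zz f + r), x ∈ interior {z : ℝ | fStar f a b z < ⊤} :=
    fun x hx => mem_interior_of_le ha0 hx.2 hz
  have hzz := fStarR_zz h1 hf1 hconv
  set ρ := rderiv (fStarR f a b) with hρ
  have sub : ∀ x ∈ Icc (zz f - r) (zz f + r), ∀ y ∈ Icc (zz f - r) (zz f + r),
      fStarR f a b x + ρ x * (y - x) ≤ fStarR f a b y :=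
    fun x hx y hy => hC.add_rderiv_mul_le (hI x hx) (interior_subset (hI y hy))
  have le : ∀ x ∈ Icc (zz f - r) (zz f + r), x ≤ fStarR f a b x :=
    fun x hx => le_fStarR h1 hf1 (interior_subset (hI x hx)).ne
  have hz0 : zz f ∈ Icc (zz f - r) (zz f + r) := ⟨by linarith, by linarith⟩
  have hLd : ∀ x ∈ Icc (zz f - r) (zz f + r), ∀ y ∈ Icc (zz f - r) (zz f + r),
      |ρ x - ρ y| ≤ L * |x - y| := fun x hx y hy => by
    simpa [Real.dist_eq] using hL.dist_le_mul x hx y hy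
  have hρ1 : ρ (zz f) = 1 := by
    have hlim : ∀ δ, 0 < δ → δ ≤ r → |ρ (zz f) - 1| ≤ L * δ := by
      intro δ hδ hδr
      have hp : zz f + δ ∈ Icc (zz f - r) (zz f + r) := ⟨by linarith, by linarith⟩
      have hm : zz f - δ ∈ Icc (zz f - r) (zz f + r) := ⟨by linarith, by linarith⟩
      have hp1 : 1 ≤ ρ (zz f + δ) := by
        have := sub _ hp _ hz0
        have := le _ hp
        nlinarith
      have hm1 : ρ (zz f - δ) ≤ 1 := by
        have := sub _ hm _ hz0
        have := le _ hm
        nlinarith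
      have e1 := abs_le.1 (hLd _ hz0 _ hp)
      have e2 := abs_le.1 (hLd _ hz0 _ hm)
      simp only [sub_add_cancel_left, abs_neg, abs_of_pos hδ, sub_sub_cancel] at e1 e2
      exact abs_le.2 ⟨by linarith, by linarith⟩
    have hle : |ρ (zz f) - 1| ≤ 0 := by
      refine le_of_forall_pos_le_add fun η hη => ?_
      have hL1 : (0 : ℝ) < L + 1 := by positivity
      refine (hlim (min r (η / (L + 1))) (lt_min hr (by positivity)) (min_le_left _ _)).trans ?_
      calc (L : ℝ) * min r (η / (L + 1)) ≤ (L + 1) * (η / (L + 1)) := by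
            gcongr
            · linarith
            · exact min_le_right _ _
        _ = 0 + η := by field_simp; ring
    have := abs_nonpos_iff.1 hle
    linarith
  have hdev : ∀ x ∈ Icc (zz f - r) (zz f + r), |ρ x - 1| ≤ L * r := by
    intro x hx
    rw [← hρ1]
    refine (hLd x hx _ hz0).trans (mul_le_mul_of_nonneg_left ?_ L.2)
    exact abs_le.2 ⟨by linarith [hx.1], by linarith [hx.2]⟩
  have key : ∀ x ∈ Icc (zz f - r) (zz f + r), ∀ y ∈ Icc (zz f - r) (zz f + r), x ≤ y →
      |(fStarR f a b x - x) - (fStarR f a b y - y)| ≤ (L * r) * |x - y| := by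
    intro x hx y hy hxy
    rw [abs_sub_comm x, abs_of_nonneg (sub_nonneg.2 hxy)]
    have s1 := sub x hx y hy
    have s2 := sub y hy x hx
    have d1 := abs_le.1 (hdev x hx)
    have d2 := abs_le.1 (hdev y hy)
    refine abs_le.2 ⟨?_, ?_⟩ <;> nlinarith
  rcases le_total x y with h | h
  · exact key x hx y hy h
  · rw [abs_sub_comm, abs_sub_comm x]; exact key y hy x hx h

end

namespace TangentConvex

variable {φ : ℝ → ℝ} {z₀ r M : ℝ}

lemma four_point (h : TangentConvex φ z₀ r M) {p q s t : ℝ} (hp : p ∈ Icc (z₀ - r) (z₀ + r))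
    (ht : t ∈ Icc (z₀ - r) (z₀ + r)) (hpq : p ≤ q) (hqt : q ≤ t) (hsum : q + s = p + t) :
    φ q + φ s ≤ φ p + φ t := by
  rcases (hpq.trans hqt).eq_or_lt with rfl | hlt
  · have hq : q = p := le_antisymm hqt hpq
    have hs : s = p := by linarith
    rw [hq, hs]
  have hd : 0 < t - p := by linarith
  have h1 := h.convex.2 hp ht
    (div_nonneg (sub_nonneg.2 hqt) hd.le) (div_nonneg (sub_nonneg.2 hpq) hd.le)
    (by field_simp; ring)
  have h2 := h.convex.2 hp ht
    (div_nonneg (sub_nonneg.2 hpq) hd.le) (div_nonneg (sub_nonneg.2 hqt) hd.le)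
    (by field_simp; ring)
  have e1 : ((t - q) / (t - p)) • p + ((q - p) / (t - p)) • t = q := by
    simp only [smul_eq_mul]; field_simp; ring
  have e2 : ((q - p) / (t - p)) • p + ((t - q) / (t - p)) • t = s := by
    have : s = p + t - q := by linarith
    simp only [smul_eq_mul, this]; field_simp; ring
  rw [e1] at h1
  rw [e2] at h2
  simp only [smul_eq_mul] at h1 h2
  have e3 : (t - q) / (t - p) + (q - p) / (t - p) = 1 := by field_simp; ring
  have e4 : ((t - q) / (t - p) + (q - p) / (t - p)) * (φ p + φ t) = 1 * (φ p + φ t) := by rw [e3]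
  linarith

/-- `(s, ν) ↦ φ (s - ν)` is submodular. -/
lemma submodular (h : TangentConvex φ z₀ r M) {s₁ s₂ ν₁ ν₂ : ℝ} (hs : s₁ ≤ s₂)
    (h1 : s₁ - max ν₁ ν₂ ∈ Icc (z₀ - r) (z₀ + r)) (h2 : s₂ - min ν₁ ν₂ ∈ Icc (z₀ - r) (z₀ + r)) :
    φ (s₂ - max ν₁ ν₂) + φ (s₁ - min ν₁ ν₂) ≤ φ (s₂ - ν₂) + φ (s₁ - ν₁) := by
  rcases le_total ν₁ ν₂ with hν | hν
  · rw [max_eq_right hν, min_eq_left hν]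
  · rw [max_eq_left hν, min_eq_right hν] at *
    rw [add_comm (φ (s₂ - ν₂))]
    exact h.four_point h1 h2 (by linarith) (by linarith) (by ring)

end TangentConvex

/-- The infimum `inf_{ν ∈ J} (ν + E_P[φ(u - ν)])`. -/
noncomputable def shiftInf {Y : Type*} [MeasurableSpace Y] (φ : ℝ → ℝ) (J : Set ℝ)
    (P : Measure Y) (u : Y → ℝ) : ℝ :=
  ⨅ ν : J, ((ν : ℝ) + ∫ y, φ (u y - ν) ∂P)

namespace TangentConvex

variable {φ : ℝ → ℝ} {z₀ r M α β : ℝ}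

lemma sub_mem (hr : r = β - α) {x ν : ℝ} (hx : x ∈ Icc α β) (hν : ν ∈ Icc (α - z₀) (β - z₀)) :
    x - ν ∈ Icc (z₀ - r) (z₀ + r) := by
  subst hr; exact ⟨by linarith [hx.1, hν.2], by linarith [hx.2, hν.1]⟩

lemma abs_le_bound (h : TangentConvex φ z₀ r M) {x : ℝ} (hx : x ∈ Icc (z₀ - r) (z₀ + r)) :
    |φ x| ≤ |z₀| + M * r := by
  have hz0 : z₀ ∈ Icc (z₀ - r) (z₀ + r) := ⟨by linarith [h.pos], by linarith [h.pos]⟩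
  have h1 := h.lip x hx z₀ hz0
  rw [h.eq] at h1
  have h2 : |x - z₀| ≤ r := abs_le.2 ⟨by linarith [hx.1], by linarith [hx.2]⟩
  have h3 : M * |x - z₀| ≤ M * r := mul_le_mul_of_nonneg_left h2 (by linarith [h.one_le])
  calc |φ x| = |z₀ + (φ x - z₀)| := by ring_nf
    _ ≤ |z₀| + |φ x - z₀| := abs_add_le _ _
    _ ≤ _ := by linarith

variable {Y : Type*} [MeasurableSpace Y] {P : Measure Y} [IsProbabilityMeasure P] {u v : Y → ℝ}

lemma integrable_comp (h : TangentConvex φ z₀ r M) (hr : r = β - α) (hφ : Measurable φ)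
    (hu : Measurable u) (hub : ∀ y, u y ∈ Icc α β) {ν : ℝ} (hν : ν ∈ Icc (α - z₀) (β - z₀)) :
    Integrable (fun y => φ (u y - ν)) P :=
  Integrable.of_bound (hφ.comp (hu.sub_const ν)).aestronglyMeasurable (|z₀| + M * r)
    (ae_of_all _ fun y => h.abs_le_bound (sub_mem hr (hub y) hν))

lemma integrable_of_mem (hu : Measurable u) (hub : ∀ y, u y ∈ Icc α β) : Integrable u P :=
  Integrable.of_mem_Icc α β hu.aemeasurable (ae_of_all _ hub)

lemma le_shift (h : TangentConvex φ z₀ r M) (hr : r = β - α) (hφ : Measurable φ)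
    (hu : Measurable u) (hub : ∀ y, u y ∈ Icc α β) {ν : ℝ} (hν : ν ∈ Icc (α - z₀) (β - z₀)) :
    α ≤ ν + ∫ y, φ (u y - ν) ∂P := by
  have : ∫ _, (α - ν) ∂P ≤ ∫ y, φ (u y - ν) ∂P := by
    refine integral_mono (integrable_const _) (h.integrable_comp hr hφ hu hub hν) fun y => ?_
    have := h.le _ (sub_mem hr (hub y) hν)
    simp only
    linarith [(hub y).1]
  simp at this
  linarith

lemma bddBelow_shift (h : TangentConvex φ z₀ r M) (hr : r = β - α) (hφ : Measurable φ)
    (hu : Measurable u) (hub : ∀ y, u y ∈ Icc α β) :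
    BddBelow (range fun ν : Icc (α - z₀) (β - z₀) => ((ν : ℝ) + ∫ y, φ (u y - ν) ∂P)) :=
  ⟨α, by rintro _ ⟨ν, rfl⟩; exact h.le_shift hr hφ hu hub ν.2⟩

lemma nonempty_Icc (h : TangentConvex φ z₀ r M) (hr : r = β - α) :
    Nonempty (Icc (α - z₀) (β - z₀)) :=
  ⟨⟨α - z₀, le_rfl, by linarith [h.pos]⟩⟩

lemma shiftInf_le (h : TangentConvex φ z₀ r M) (hr : r = β - α) (hφ : Measurable φ)
    (hu : Measurable u) (hub : ∀ y, u y ∈ Icc α β) {ν : ℝ} (hν : ν ∈ Icc (α - z₀) (β - z₀)) :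
    shiftInf φ (Icc (α - z₀) (β - z₀)) P u ≤ ν + ∫ y, φ (u y - ν) ∂P :=
  ciInf_le (h.bddBelow_shift hr hφ hu hub) ⟨ν, hν⟩

lemma shiftInf_mem (h : TangentConvex φ z₀ r M) (hr : r = β - α) (hφ : Measurable φ)
    (hu : Measurable u) (hub : ∀ y, u y ∈ Icc α β) :
    shiftInf φ (Icc (α - z₀) (β - z₀)) P u ∈ Icc α β := by
  have := h.nonempty_Icc hr
  have hβ : β - z₀ ∈ Icc (α - z₀) (β - z₀) := ⟨by linarith [h.pos], le_rfl⟩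
  refine ⟨le_ciInf fun ν => h.le_shift hr hφ hu hub ν.2,
    (h.shiftInf_le hr hφ hu hub hβ).trans ?_⟩
  have hz0 : z₀ ∈ Icc (z₀ - r) (z₀ + r) := ⟨by linarith [h.pos], by linarith [h.pos]⟩
  have : ∫ y, φ (u y - (β - z₀)) ∂P ≤ ∫ _, z₀ ∂P := by
    refine integral_mono (h.integrable_comp hr hφ hu hub hβ) (integrable_const _) fun y => ?_
    calc φ (u y - (β - z₀)) ≤ φ z₀ :=
          h.mono (sub_mem hr (hub y) hβ) hz0 (by linarith [(hub y).2])
      _ = z₀ := h.eq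
  simp at this
  linarith

/-- `shiftInf` is `M`-Lipschitz with respect to the `L¹` distance. -/
lemma shiftInf_le_add (h : TangentConvex φ z₀ r M) (hr : r = β - α) (hφ : Measurable φ)
    (hu : Measurable u) (hub : ∀ y, u y ∈ Icc α β) (hv : Measurable v)
    (hvb : ∀ y, v y ∈ Icc α β) :
    shiftInf φ (Icc (α - z₀) (β - z₀)) P u ≤
      shiftInf φ (Icc (α - z₀) (β - z₀)) P v + M * ∫ y, |u y - v y| ∂P := by
  have := h.nonempty_Icc hr
  rw [← sub_le_iff_le_add]
  refine le_ciInf fun ν => ?_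
  have hint : Integrable (fun y => M * |u y - v y|) P :=
    ((integrable_of_mem hu hub).sub (integrable_of_mem hv hvb)).abs.const_mul M
  have h1 : ∫ y, φ (u y - ν) ∂P ≤ ∫ y, (φ (v y - ν) + M * |u y - v y|) ∂P := by
    refine integral_mono (h.integrable_comp hr hφ hu hub ν.2)
      ((h.integrable_comp hr hφ hv hvb ν.2).add hint) fun y => ?_
    have := h.lip _ (sub_mem hr (hub y) ν.2) _ (sub_mem hr (hvb y) ν.2)
    rw [sub_sub_sub_cancel_right] at this
    simp only
    linarith [le_abs_self (φ (u y - ν) - φ (v y - ν))]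
  rw [integral_add (h.integrable_comp hr hφ hv hvb ν.2) hint, integral_const_mul] at h1
  have h2 := h.shiftInf_le hr hφ hu hub ν.2 (P := P)
  linarith

lemma tendsto_shiftInf (h : TangentConvex φ z₀ r M) (hr : r = β - α) (hφ : Measurable φ)
    (hu : Measurable u) (hub : ∀ y, u y ∈ Icc α β) {s : ℕ → Y → ℝ} (hs : ∀ j, Measurable (s j))
    (hsb : ∀ j y, s j y ∈ Icc α β) (hlim : ∀ y, Tendsto (fun j => s j y) atTop (𝓝 (u y))) :
    Tendsto (fun j => shiftInf φ (Icc (α - z₀) (β - z₀)) P (s j)) atTop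
      (𝓝 (shiftInf φ (Icc (α - z₀) (β - z₀)) P u)) := by
  have hL1 : Tendsto (fun j => M * ∫ y, |s j y - u y| ∂P) atTop (𝓝 0) := by
    have : Tendsto (fun j => ∫ y, |s j y - u y| ∂P) atTop (𝓝 (∫ _, (0 : ℝ) ∂P)) := by
      refine tendsto_integral_of_dominated_convergence (fun _ => β - α)
        (fun j => ((hs j).sub hu).abs.aestronglyMeasurable) (integrable_const _)
        (fun j => ae_of_all _ fun y => ?_) (ae_of_all _ fun y => ?_)
      · rw [Real.norm_eq_abs, abs_abs]
        exact abs_le.2 ⟨by linarith [(hsb j y).1, (hub y).2], by linarith [(hsb j y).2, (hub y).1]⟩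
      · have := ((hlim y).sub_const (u y)).abs
        simpa using this
    simpa using this.const_mul M
  rw [tendsto_iff_dist_tendsto_zero]
  refine squeeze_zero (fun _ => dist_nonneg) (fun j => ?_) hL1
  have h1 := h.shiftInf_le_add hr hφ (hs j) (hsb j) hu hub (P := P)
  have h2 := h.shiftInf_le_add hr hφ hu hub (hs j) (hsb j) (P := P)
  simp only [abs_sub_comm (u _)] at h2
  rw [Real.dist_eq]
  exact abs_le.2 ⟨by linarith, by linarith⟩

end TangentConvex

section

variable {f : ℝ → ℝ} {a : ℝ} {b : EReal} {α β : ℝ} {Y : Type*} [MeasurableSpace Y]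
  {P : Measure Y} [IsProbabilityMeasure P] {u : Y → ℝ}

lemma add_sub_le_fStarR (h1 : (1 : ℝ) ∈ Dom a b) (hf1 : f 1 = 0)
    (hconv : ConvexOn ℝ (Dom a b) f) {x y : ℝ}
    (hx : x ∈ interior {z : ℝ | fStar f a b z < ⊤}) (hy : fStar f a b y ≠ ⊤)
    (hxy : (zz f ≤ x ∧ x ≤ y) ∨ (y ≤ x ∧ x ≤ zz f)) :
    fStarR f a b x + (y - x) ≤ fStarR f a b y := by
  have hC := convexOn_fStarR (f := f) h1 hf1
  have hzz := fStarR_zz h1 hf1 hconv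
  rcases eq_or_ne x (zz f) with rfl | hne
  · rw [hzz]
    linarith [le_fStarR h1 hf1 hy]
  have hsub := hC.add_rderiv_mul_le hx (lt_top_iff_ne_top.2 hy)
  have hsub0 := hC.add_rderiv_mul_le hx (y := zz f)
    (by rw [mem_ofPred_eq, fStar_zz h1 hf1 hconv]; exact EReal.coe_lt_top _)
  have hle := le_fStarR h1 hf1 (interior_subset hx).ne
  rw [hzz] at hsub0
  rcases hxy with ⟨h0, h⟩ | ⟨h, h0⟩
  · have h0 := lt_of_le_of_ne h0 hne.symm
    have : 1 ≤ rderiv (fStarR f a b) x := by nlinarith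
    nlinarith
  · have h0 := lt_of_le_of_ne h0 hne
    have : rderiv (fStarR f a b) x ≤ 1 := by nlinarith
    nlinarith

/-- Restricting the infimum defining the cumulant generating function to
`[α - z₀, β - z₀]` does not change it. -/
lemma cgfR_eq_shiftInf (ha0 : 0 ≤ a) (h1 : (1 : ℝ) ∈ Dom a b) (hf1 : f 1 = 0)
    (hconv : ConvexOn ℝ (Dom a b) f) (hαβ : α < β)
    (hz : zz f + (β - α) ∈ interior {z : ℝ | fStar f a b z < ⊤})
    (hu : Measurable u) (hub : ∀ y, u y ∈ Icc α β) :
    cgfR f a b P u = shiftInf (fStarR f a b) (Icc (α - zz f) (β - zz f)) P u := by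
  have hT := tangentConvex_fStarR ha0 h1 hf1 hconv (sub_pos.2 hαβ) hz
  have hφ := measurable_fStarR (f := f) (b := b) ha0
  set φ := fStarR f a b with hφdef
  set J := Icc (α - zz f) (β - zz f)
  have hJ : Nonempty J := hT.nonempty_Icc rfl
  have hC := convexOn_fStarR (f := f) h1 hf1
  have hfin : ∀ x ∈ Icc (zz f - (β - α)) (zz f + (β - α)), fStar f a b x ≠ ⊤ :=
    fun x hx => fStar_ne_top_of_le ha0 hx.2 (interior_subset hz).ne
  have hin : ∀ ν ∈ J, eIntegral P (fun x => fStar f a b (u x - ν)) =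
      ((∫ y, φ (u y - ν) ∂P : ℝ) : EReal) := by
    intro ν hν
    exact if_pos ⟨ae_of_all _ fun y => hfin _ (TangentConvex.sub_mem rfl (hub y) hν),
      hT.integrable_comp rfl hφ hu hub hν⟩
  have hlow : ∀ ν : ℝ, ((shiftInf φ J P u : ℝ) : EReal) ≤
      (ν : EReal) + eIntegral P (fun x => fStar f a b (u x - ν)) := by
    intro ν
    by_cases hc : (∀ᵐ x ∂P, fStar f a b (u x - ν) ≠ ⊤) ∧
        Integrable (fun x => (fStar f a b (u x - ν)).toReal) P
    swap
    · rw [eIntegral, if_neg hc, EReal.coe_add_top]; exact le_top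
    rw [eIntegral, if_pos hc, ← EReal.coe_add, EReal.coe_le_coe_iff]
    change _ ≤ ν + ∫ x, φ (u x - ν) ∂P
    have hmono : ∀ ν' ∈ J, (∀ y, fStar f a b (u y - ν) ≠ ⊤ →
        ν' - ν + φ (u y - ν') ≤ φ (u y - ν)) → shiftInf φ J P u ≤ ν + ∫ x, φ (u x - ν) ∂P := by
      intro ν' hν' hle
      refine (hT.shiftInf_le rfl hφ hu hub hν').trans ?_
      have := integral_mono_ae
        ((integrable_const (ν' - ν)).add (hT.integrable_comp rfl hφ hu hub hν'))
        hc.2 (hc.1.mono fun y hy => hle y hy) (μ := P)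
      rw [integral_add' (integrable_const _) (hT.integrable_comp rfl hφ hu hub hν')] at this
      simp at this
      change _ ≤ ∫ x, φ (u x - ν) ∂P at this
      linarith
    rcases lt_or_ge ν (α - zz f) with hlt | hge
    · refine hmono (α - zz f) ⟨le_rfl, by linarith⟩ fun y hy => ?_
      have := add_sub_le_fStarR h1 hf1 hconv (mem_interior_of_le ha0
        (TangentConvex.sub_mem (z₀ := zz f) rfl (hub y) ⟨le_rfl, by linarith⟩).2 hz) hy
        (Or.inl ⟨by linarith [(hub y).1], by linarith⟩)
      linarith
    rcases le_or_gt ν (β - zz f) with hle | hgt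
    · exact hT.shiftInf_le rfl hφ hu hub ⟨hge, hle⟩
    · refine hmono (β - zz f) ⟨by linarith, le_rfl⟩ fun y hy => ?_
      have := add_sub_le_fStarR h1 hf1 hconv (mem_interior_of_le ha0
        (TangentConvex.sub_mem (z₀ := zz f) rfl (hub y) ⟨by linarith, le_rfl⟩).2 hz) hy
        (Or.inr ⟨by linarith, by linarith [(hub y).2]⟩)
      linarith
  have hup : ∀ ν ∈ J, cgf f a b P u ≤ ((ν + ∫ y, φ (u y - ν) ∂P : ℝ) : EReal) := by
    intro ν hν
    rw [EReal.coe_add, ← hin ν hν]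
    exact iInf_le _ ν
  have hge : ((shiftInf φ J P u : ℝ) : EReal) ≤ cgf f a b P u := le_iInf hlow
  have htop : cgf f a b P u ≠ ⊤ :=
    ((hup _ hJ.some.2).trans_lt (EReal.coe_lt_top _)).ne
  have hbot : cgf f a b P u ≠ ⊥ := ((EReal.bot_lt_coe _).trans_le hge).ne'
  have hcoe : ((cgfR f a b P u : ℝ) : EReal) = cgf f a b P u := EReal.coe_toReal htop hbot
  refine le_antisymm (le_ciInf fun ν => ?_) ?_
  · have := hup ν ν.2
    rwa [← hcoe, EReal.coe_le_coe_iff] at this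
  · rwa [← hcoe, EReal.coe_le_coe_iff] at hge

end

section

variable {Y : Type*} [MeasurableSpace Y]

instance isProbabilityMeasure_empMeas {m : ℕ} [NeZero m] (y : Fin m → Y) :
    IsProbabilityMeasure (empMeas m y) := by
  constructor
  simp only [empMeas, Measure.smul_apply, Measure.finsetSum_apply, measure_univ, Finset.sum_const,
    Finset.card_univ, Fintype.card_fin, smul_eq_mul, nsmul_eq_mul, mul_one]
  exact ENNReal.inv_mul_cancel (by simp [NeZero.ne m]) (ENNReal.natCast_ne_top m)

lemma integral_empMeas {m : ℕ} (y : Fin m → Y) {h : Y → ℝ} (hh : Measurable h) :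
    ∫ x, h x ∂(empMeas m y) = (m : ℝ)⁻¹ * ∑ k, h (y k) := by
  rw [empMeas, integral_smul_measure, integral_finsetSum_measure]
  · simp [integral_dirac' _ _ hh.stronglyMeasurable]
  · exact fun k _ => (integrable_dirac' hh.stronglyMeasurable (by simp))

end

namespace TangentConvex

variable {φ : ℝ → ℝ} {z₀ r M α β : ℝ}

lemma exists_countable_shiftInf_eq (h : TangentConvex φ z₀ r M) (hr : r = β - α)
    (hφ : Measurable φ) :
    ∃ D ⊆ Icc (α - z₀) (β - z₀), D.Countable ∧ D.Nonempty ∧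
      ∀ {Y : Type*} [MeasurableSpace Y] (P : Measure Y) [IsProbabilityMeasure P] (u : Y → ℝ),
        Measurable u → (∀ y, u y ∈ Icc α β) →
          shiftInf φ (Icc (α - z₀) (β - z₀)) P u = shiftInf φ D P u := by
  have hJ := h.nonempty_Icc hr
  set J := Icc (α - z₀) (β - z₀)
  refine ⟨range fun k => (TopologicalSpace.denseSeq J k : ℝ), ?_, countable_range _,
    range_nonempty _, fun {Y} _ P _ u hu hub => ?_⟩
  · rintro _ ⟨k, rfl⟩
    exact (TopologicalSpace.denseSeq J k).2
  have hbdd : BddBelow (range fun ν : range fun k => (TopologicalSpace.denseSeq J k : ℝ) =>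
      ((ν : ℝ) + ∫ y, φ (u y - ν) ∂P)) := by
    refine ⟨α, ?_⟩
    rintro _ ⟨⟨_, k, rfl⟩, rfl⟩
    exact h.le_shift hr hφ hu hub (TopologicalSpace.denseSeq J k).2
  refine le_antisymm ?_ ?_
  · have : Nonempty (range fun k => (TopologicalSpace.denseSeq J k : ℝ)) :=
      (range_nonempty _).to_subtype
    refine le_ciInf ?_
    rintro ⟨_, k, rfl⟩
    exact h.shiftInf_le hr hφ hu hub (TopologicalSpace.denseSeq J k).2
  · refine le_ciInf fun ν => le_of_forall_pos_le_add fun ε hε => ?_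
    have hM := h.one_le
    obtain ⟨k, hk⟩ := (TopologicalSpace.denseRange_denseSeq J).exists_dist_lt ν
      (show 0 < ε / (1 + M) by positivity)
    rw [Subtype.dist_eq, Real.dist_eq] at hk
    set ν' := TopologicalSpace.denseSeq J k
    refine (ciInf_le hbdd ⟨_, k, rfl⟩).trans ?_
    have h1 : ∫ y, φ (u y - ν') ∂P ≤ ∫ y, (φ (u y - ν) + M * |(ν : ℝ) - ν'|) ∂P := by
      refine integral_mono (h.integrable_comp hr hφ hu hub ν'.2)
        ((h.integrable_comp hr hφ hu hub ν.2).add (integrable_const _)) fun y => ?_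
      have := h.lip _ (sub_mem hr (hub y) ν'.2) _ (sub_mem hr (hub y) ν.2)
      rw [sub_sub_sub_cancel_left] at this
      simp only
      linarith [le_abs_self (φ (u y - ν') - φ (u y - ν))]
    rw [integral_add (h.integrable_comp hr hφ hu hub ν.2) (integrable_const _)] at h1
    simp only [integral_const, probReal_univ, one_smul] at h1
    rw [lt_div_iff₀ (by positivity)] at hk
    have := (abs_le.1 (le_refl |(ν : ℝ) - ν'|)).1
    change (ν' : ℝ) + ∫ y, φ (u y - ν') ∂P ≤ _
    nlinarith

/-- Changing one sample point changes the empirical `shiftInf` by at most the value attained when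
that point moves from `α` to `β` while all the others stay at `α`. -/
lemma shiftInf_empMeas_le (h : TangentConvex φ z₀ r M) (hr : r = β - α) (hφ : Measurable φ)
    {Y : Type*} [MeasurableSpace Y] {u : Y → ℝ} (hu : Measurable u) (hub : ∀ y, u y ∈ Icc α β)
    {m : ℕ} [NeZero m] {y y' : Fin m → Y} {j : Fin m} (hyy : ∀ k, k ≠ j → y' k = y k)
    {z : ℝ} (hz : z ∈ Icc (z₀ - r) z₀) :
    shiftInf φ (Icc (α - z₀) (β - z₀)) (empMeas m y') u ≤
      shiftInf φ (Icc (α - z₀) (β - z₀)) (empMeas m y) u +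
        (-z + (((m : ℝ) - 1) / m) * φ z + (1 / (m : ℝ)) * φ (r + z)) := by
  have hJ := h.nonempty_Icc hr
  have hm : (0 : ℝ) < m := by exact_mod_cast NeZero.pos m
  rw [← sub_le_iff_le_add]
  refine le_ciInf fun ⟨ν₂, h₂⟩ => ?_
  set ν₁ := α - z with hν₁
  have h₁ : ν₁ ∈ Icc (α - z₀) (β - z₀) := ⟨by linarith [hz.2], by linarith [hz.1]⟩
  have hmax : max ν₁ ν₂ ∈ Icc (α - z₀) (β - z₀) := max_rec' (· ∈ Icc (α - z₀) (β - z₀)) h₁ h₂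
  have hmin : min ν₁ ν₂ ∈ Icc (α - z₀) (β - z₀) := min_rec' (· ∈ Icc (α - z₀) (β - z₀)) h₁ h₂
  have hα : α ∈ Icc α β := ⟨le_rfl, by linarith [h.pos]⟩
  have hβ : β ∈ Icc α β := ⟨by linarith [h.pos], le_rfl⟩
  have hup := h.shiftInf_le hr hφ hu hub hmax (P := empMeas m y')
  rw [integral_empMeas y' (h := fun x => φ (u x - max ν₁ ν₂)) (hφ.comp (hu.sub_const _))] at hup
  rw [integral_empMeas y (h := fun x => φ (u x - ν₂)) (hφ.comp (hu.sub_const _))]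
  have hcoord : ∀ k, φ (u (y' k) - max ν₁ ν₂) + φ (α - min ν₁ ν₂) ≤
      φ (u (y k) - ν₂) + (if k = j then φ (β - ν₁) else φ (α - ν₁)) := by
    intro k
    split_ifs with hk
    · have e1 : φ (u (y' k) - max ν₁ ν₂) ≤ φ (β - max ν₁ ν₂) :=
        h.mono (sub_mem hr (hub _) hmax) (sub_mem hr hβ hmax) (by linarith [(hub (y' k)).2])
      have e2 : φ (α - ν₂) ≤ φ (u (y k) - ν₂) :=
        h.mono (sub_mem hr hα h₂) (sub_mem hr (hub _) h₂) (by linarith [(hub (y k)).1])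
      have e3 := h.submodular (s₁ := α) (s₂ := β) (ν₁ := ν₂) (ν₂ := ν₁) hα.2
        (by rw [max_comm]; exact sub_mem hr hα hmax) (by rw [min_comm]; exact sub_mem hr hβ hmin)
      rw [max_comm, min_comm] at e3
      linarith
    · rw [hyy k hk]
      exact h.submodular (hub (y k)).1 (sub_mem hr hα hmax) (sub_mem hr (hub _) hmin)
  have hsum := Finset.sum_le_sum fun k (_ : k ∈ Finset.univ) => hcoord k
  rw [Finset.sum_add_distrib, Finset.sum_add_distrib, Finset.sum_const, Finset.card_univ,
    Fintype.card_fin, nsmul_eq_mul, Finset.sum_ite, Finset.sum_const, Finset.sum_const,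
    Finset.filter_eq' Finset.univ j, Finset.filter_ne' Finset.univ j] at hsum
  simp only [Finset.mem_univ, if_true, Finset.card_singleton, one_smul,
    Finset.card_erase_of_mem, Finset.card_univ, Fintype.card_fin, nsmul_eq_mul,
    Nat.cast_sub (NeZero.one_le (n := m)), Nat.cast_one] at hsum
  have hge := h.le _ (sub_mem hr hα hmin)
  have hαz : α - ν₁ = z := by rw [hν₁]; ring
  have hβz : β - ν₁ = r + z := by rw [hν₁, hr]; ring
  rw [hαz, hβz] at hsum
  have hmm : max ν₁ ν₂ + min ν₁ ν₂ = ν₁ + ν₂ := max_add_min _ _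
  have hdiv := mul_le_mul_of_nonneg_left hsum (inv_nonneg.2 hm.le)
  have e1 : (m : ℝ)⁻¹ * (m * φ (α - min ν₁ ν₂)) = φ (α - min ν₁ ν₂) := by field_simp
  rw [mul_add, e1] at hdiv
  have e2 : (m : ℝ)⁻¹ * (∑ k, φ (u (y k) - ν₂) + (φ (r + z) + (m - 1) * φ z)) =
      (m : ℝ)⁻¹ * ∑ k, φ (u (y k) - ν₂) + ((((m : ℝ) - 1) / m) * φ z + (1 / (m : ℝ)) * φ (r + z)) := by
    field_simp; ring
  rw [e2] at hdiv
  linarith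

lemma measurable_shiftInf_empMeas {D : Set ℝ} (hD : D.Countable) (hφ : Measurable φ)
    {Y : Type*} [MeasurableSpace Y] {u : Y → ℝ} (hu : Measurable u) (m : ℕ) :
    Measurable fun y : Fin m → Y => shiftInf φ D (empMeas m y) u := by
  have := hD.to_subtype
  refine Measurable.iInf fun ν => ?_
  simp_rw [integral_empMeas _ (h := fun x => φ (u x - ν)) (hφ.comp (hu.sub_const _))]
  refine (measurable_const.add (measurable_const.mul (Finset.measurable_sum _ fun k _ => ?_)))
  exact hφ.comp ((hu.comp (measurable_pi_apply k)).sub_const _)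

end TangentConvex

open ProbabilityTheory (HasSubgaussianMGF)

section McDiarmid

lemma integrable_exp_of_abs_le {A : Type*} [MeasurableSpace A] {μ : Measure A}
    [IsFiniteMeasure μ] {H : A → ℝ} (hH : Measurable H) {C : ℝ} (hC : ∀ x, |H x| ≤ C) (t : ℝ) :
    Integrable (fun x => Real.exp (t * H x)) μ := by
  refine Integrable.of_bound (hH.const_mul t).exp.aestronglyMeasurable (Real.exp (|t| * C))
    (ae_of_all _ fun x => ?_)
  rw [Real.norm_eq_abs, abs_of_pos (Real.exp_pos _), Real.exp_le_exp]
  calc t * H x ≤ |t * H x| := le_abs_self _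
    _ = |t| * |H x| := abs_mul _ _
    _ ≤ |t| * C := mul_le_mul_of_nonneg_left (hC x) (abs_nonneg t)

lemma abs_integral_le_of_abs_le {A : Type*} [MeasurableSpace A] {μ : Measure A}
    [IsProbabilityMeasure μ] {H : A → ℝ} {C : ℝ} (hC : ∀ x, |H x| ≤ C) : |∫ x, H x ∂μ| ≤ C := by
  have := norm_integral_le_of_norm_le_const (μ := μ) (f := H) (ae_of_all _ hC)
  simpa using this

/-- Tensorization of the sub-Gaussian property: fibrewise fluctuations together with
the fluctuations of the fibrewise means. -/
lemma hasSubgaussianMGF_prod {A B : Type*} [MeasurableSpace A] [MeasurableSpace B]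
    {μ : Measure A} {ν : Measure B} [IsProbabilityMeasure μ] [IsProbabilityMeasure ν]
    {H : A × B → ℝ} (hH : Measurable H) {C : ℝ} (hC : ∀ p, |H p| ≤ C) {s c : ℝ≥0}
    (hfib : ∀ x, HasSubgaussianMGF (fun y => H (x, y) - ∫ y, H (x, y) ∂ν) s ν)
    (hmean : ∀ x x', ∫ y, H (x', y) ∂ν ≤ ∫ y, H (x, y) ∂ν + c) :
    HasSubgaussianMGF (fun p => H p - ∫ p, H p ∂(μ.prod ν)) (s + (c / 2) ^ 2) (μ.prod ν) := by
  set G : A → ℝ := fun x => ∫ y, H (x, y) ∂ν with hG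
  have hGm : Measurable G := hH.stronglyMeasurable.integral_prod_right'.measurable
  have hGC : ∀ x, |G x| ≤ C := fun x => abs_integral_le_of_abs_le fun y => hC (x, y)
  have hHint : Integrable H (μ.prod ν) :=
    Integrable.of_bound hH.aestronglyMeasurable C (ae_of_all _ hC)
  have hEG : ∫ p, H p ∂(μ.prod ν) = ∫ x, G x ∂μ := integral_prod H hHint
  have hEC : |∫ p, H p ∂(μ.prod ν)| ≤ C := abs_integral_le_of_abs_le hC
  have hA : Nonempty A := Measure.nonempty_of_neZero μ
  have hGbdd : BddBelow (range G) := ⟨-C, by rintro _ ⟨x, rfl⟩; exact (abs_le.1 (hGC x)).1⟩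
  have hGsub : HasSubgaussianMGF (fun x => G x - ∫ x, G x ∂μ) ((c / 2) ^ 2) μ := by
    have := ProbabilityTheory.hasSubgaussianMGF_of_mem_Icc (μ := μ) (X := G) (a := ⨅ x, G x)
      (b := (⨅ x, G x) + c) hGm.aemeasurable (ae_of_all _ fun x => ⟨ciInf_le hGbdd x, by
        rw [← sub_le_iff_le_add]
        exact le_ciInf fun x' => by linarith [hmean x' x]⟩)
    simpa using this
  have hHE : ∀ p, |H p - ∫ p, H p ∂(μ.prod ν)| ≤ C + C := fun p =>
    (abs_sub _ _).trans (add_le_add (hC p) hEC)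
  have hint := fun t => integrable_exp_of_abs_le (μ := μ.prod ν) (hH.sub_const _) hHE t
  refine ⟨hint, fun t => ?_⟩
  rw [ProbabilityTheory.mgf, integral_prod _ (hint t)]
  have hinner : ∀ x, ∫ y, Real.exp (t * (H (x, y) - ∫ p, H p ∂(μ.prod ν))) ∂ν ≤
      Real.exp (t * (G x - ∫ x, G x ∂μ)) * Real.exp (s * t ^ 2 / 2) := by
    intro x
    have := (hfib x).mgf_le t
    rw [ProbabilityTheory.mgf] at this
    have e : ∀ y, Real.exp (t * (H (x, y) - ∫ p, H p ∂(μ.prod ν))) =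
        Real.exp (t * (G x - ∫ x, G x ∂μ)) * Real.exp (t * (H (x, y) - G x)) := by
      intro y
      rw [← Real.exp_add, hEG]; ring_nf
    simp_rw [e]
    rw [integral_const_mul]
    exact mul_le_mul_of_nonneg_left this (Real.exp_nonneg _)
  calc ∫ x, ∫ y, Real.exp (t * (H (x, y) - ∫ p, H p ∂(μ.prod ν))) ∂ν ∂μ
      ≤ ∫ x, Real.exp (t * (G x - ∫ x, G x ∂μ)) * Real.exp (s * t ^ 2 / 2) ∂μ :=
        integral_mono (hint t).integral_prod_left ((hGsub.integrable_exp_mul t).mul_const _) hinner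
    _ = (∫ x, Real.exp (t * (G x - ∫ x, G x ∂μ)) ∂μ) * Real.exp (s * t ^ 2 / 2) :=
        integral_mul_const _ _
    _ ≤ Real.exp (((c / 2) ^ 2 : ℝ≥0) * t ^ 2 / 2) * Real.exp (s * t ^ 2 / 2) :=
        mul_le_mul_of_nonneg_right (hGsub.mgf_le t) (Real.exp_nonneg _)
    _ = _ := by
        rw [← Real.exp_add]; push_cast; ring_nf

/-- **McDiarmid's inequality**, in moment generating function form. -/
lemma hasSubgaussianMGF_of_bounded_differences {Y : Type*} [MeasurableSpace Y] (P : Measure Y)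
    [IsProbabilityMeasure P] (c : ℝ≥0) (n : ℕ) {F : (Fin n → Y) → ℝ} (hF : Measurable F) {C : ℝ}
    (hC : ∀ y, |F y| ≤ C)
    (hdiff : ∀ (y y' : Fin n → Y) (j : Fin n), (∀ k, k ≠ j → y' k = y k) → F y' ≤ F y + c) :
    HasSubgaussianMGF (fun y => F y - ∫ y, F y ∂(Measure.pi fun _ => P)) (n * (c / 2) ^ 2)
      (Measure.pi fun _ => P) := by
  induction n with
  | zero =>
    have : (fun y => F y - ∫ y, F y ∂(Measure.pi fun _ => P)) = fun _ => 0 := by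
      ext y
      have : ∀ y', F y' = F y := fun y' => congrArg F (Subsingleton.elim _ _)
      simp [this]
    rw [this]
    simp
  | succ n ih =>
    have he := measurePreserving_piFinSuccAbove (fun _ : Fin (n + 1) => P) 0
    set e := MeasurableEquiv.piFinSuccAbove (fun _ : Fin (n + 1) => Y) 0
    have hsymm : ∀ x y, e.symm (x, y) = Fin.cons x y := fun x y => by
      simp [e, MeasurableEquiv.piFinSuccAbove, Fin.insertNthEquiv]
    have hH : Measurable fun p => F (e.symm p) := hF.comp e.symm.measurable
    have key := hasSubgaussianMGF_prod (μ := P) (ν := Measure.pi fun _ : Fin n => P) hH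
      (fun p => hC _) (s := n * (c / 2) ^ 2) (c := c)
      (fun x => ih (F := fun y => F (e.symm (x, y))) (hH.comp measurable_prodMk_left)
        (fun y => hC _) fun y y' j hj => ?_) (fun x x' => ?_)
    · have hmap := he.map_eq
      change Measure.map e _ = P.prod _ at hmap
      have hint : ∫ p, F (e.symm p) ∂(P.prod (Measure.pi fun _ : Fin n => P)) =
          ∫ y, F y ∂(Measure.pi fun _ => P) := by
        rw [← hmap, integral_map_equiv]
        simp
      rw [← hmap] at key
      have := HasSubgaussianMGF.of_map e.measurable.aemeasurable key
      rw [hmap, hint] at this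
      convert this using 1
      · ext y; simp
      · push_cast; ring
    · refine hdiff _ _ j.succ fun k hk => ?_
      rw [hsymm, hsymm]
      refine Fin.cases ?_ (fun k => ?_) k hk
      · simp
      · intro hk
        simpa using hj k fun h => hk (h ▸ rfl)
    · have hint : ∀ x, Integrable (fun y => F (e.symm (x, y))) (Measure.pi fun _ : Fin n => P) :=
        fun x => Integrable.of_bound (hH.comp measurable_prodMk_left).aestronglyMeasurable C
          (ae_of_all _ fun y => hC _)
      calc ∫ y, F (e.symm (x', y)) ∂(Measure.pi fun _ : Fin n => P)
          ≤ ∫ y, (F (e.symm (x, y)) + c) ∂(Measure.pi fun _ : Fin n => P) := by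
            refine integral_mono (hint x') ((hint x).add (integrable_const _)) fun y => ?_
            refine hdiff _ _ 0 fun k hk => ?_
            rw [hsymm, hsymm]
            refine Fin.cases (fun h => absurd rfl h) (fun k _ => ?_) k hk
            simp
        _ = _ := by
            rw [integral_add (hint x) (integrable_const _)]
            simp

end McDiarmid

section Signs

/-- The real sign attached to a Boolean. -/
noncomputable def boolSign (s : Bool) : ℝ := if s then 1 else -1

@[simp] lemma boolSign_true : boolSign true = 1 := rfl

@[simp] lemma boolSign_false : boolSign false = -1 := by simp [boolSign]

lemma boolSign_not (s : Bool) : boolSign (!s) = -boolSign s := by cases s <;> simp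

lemma abs_boolSign (s : Bool) : |boolSign s| = 1 := by cases s <;> simp

lemma sum_signs_succ {n : ℕ} (F : (Fin (n + 1) → Bool) → ℝ) :
    ∑ σ, F σ = ∑ σ : Fin n → Bool, (F (Fin.cons true σ) + F (Fin.cons false σ)) := by
  rw [← (Fin.consEquiv fun _ => Bool).sum_comp, Fintype.sum_prod_type_right]
  simp [Fin.consEquiv]

lemma sum_signs_not {n : ℕ} (F : (Fin n → Bool) → ℝ) :
    ∑ σ : Fin n → Bool, F (fun k => !(σ k)) = ∑ σ, F σ :=
  (Equiv.arrowCongr (Equiv.refl (Fin n)) Equiv.boolNot).sum_comp F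

lemma sum_signs_sq (n : ℕ) (c : ℝ) :
    ∑ σ : Fin n → Bool, (c + ∑ k, boolSign (σ k)) ^ 2 = 2 ^ n * (c ^ 2 + n) := by
  induction n generalizing c with
  | zero => simp
  | succ n ih =>
    rw [sum_signs_succ, Finset.sum_add_distrib]
    simp only [Fin.sum_univ_succ, Fin.cons_zero, Fin.cons_succ, ← add_assoc]
    rw [ih, ih]
    simp only [boolSign_true, boolSign_false]
    push_cast
    ring

lemma sum_signs_abs_le (n : ℕ) :
    ∑ σ : Fin n → Bool, |∑ k, boolSign (σ k)| ≤ 2 ^ n * √n := by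
  have h1 := sum_signs_sq n 0
  simp only [zero_add, ne_eq, OfNat.ofNat_ne_zero, not_false_eq_true, zero_pow] at h1
  have h2 := sq_sum_le_card_mul_sum_sq (s := (Finset.univ : Finset (Fin n → Bool)))
    (f := fun σ => |∑ k, boolSign (σ k)|)
  simp only [sq_abs, h1, Finset.card_univ, Fintype.card_pi, Fintype.card_bool, Finset.prod_const,
    Fintype.card_fin] at h2
  refine abs_le_of_sq_le_sq' (h2.trans_eq ?_) (by positivity) |>.2
  rw [mul_pow, Real.sq_sqrt (by positivity)]
  push_cast
  ring

variable {ι : Type*} [Nonempty ι]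

lemma iSup_add_iSup_neg_le {b a w : ι → ℝ} {C : ℝ} (hb : ∀ i, |b i| ≤ C) (hw : ∀ i, |w i| ≤ C)
    (haw : ∀ i j, |a i - a j| ≤ |w i - w j|) :
    (⨆ i, (b i + a i)) + (⨆ i, (b i - a i)) ≤ (⨆ i, (b i + w i)) + (⨆ i, (b i - w i)) := by
  have hp : BddAbove (range fun i => b i + w i) :=
    ⟨C + C, by rintro _ ⟨i, rfl⟩; exact add_le_add (abs_le.1 (hb i)).2 (abs_le.1 (hw i)).2⟩
  have hm : BddAbove (range fun i => b i - w i) :=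
    ⟨C + C, by rintro _ ⟨i, rfl⟩; dsimp only; linarith [(abs_le.1 (hb i)).2, (abs_le.1 (hw i)).1]⟩
  have key (i j : ι) : (b i + a i) + (b j - a j) ≤
      (⨆ i, (b i + w i)) + (⨆ i, (b i - w i)) := by
    have h1 := le_ciSup hp i
    have h2 := le_ciSup hm j
    have h3 := le_ciSup hp j
    have h4 := le_ciSup hm i
    have h5 := (le_abs_self _).trans (haw i j)
    rcases abs_cases (w i - w j) with h | h <;> linarith
  rw [← le_sub_iff_add_le]
  refine ciSup_le fun i => ?_
  rw [le_sub_comm]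
  refine ciSup_le fun j => ?_
  linarith [key i j]

lemma sum_signs_contraction (n : ℕ) {b : ι → ℝ} {a w : ι → Fin n → ℝ} {B C : ℝ}
    (hb : ∀ i, |b i| ≤ B) (ha : ∀ i k, |a i k| ≤ C) (hw : ∀ i k, |w i k| ≤ C)
    (haw : ∀ i j k, |a i k - a j k| ≤ |w i k - w j k|) :
    ∑ σ : Fin n → Bool, ⨆ i, (b i + ∑ k, boolSign (σ k) * a i k) ≤
      ∑ σ : Fin n → Bool, ⨆ i, (b i + ∑ k, boolSign (σ k) * w i k) := by
  induction n generalizing b B with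
  | zero => simp
  | succ n ih =>
    rw [sum_signs_succ, sum_signs_succ]
    simp only [Fin.sum_univ_succ, Fin.cons_zero, Fin.cons_succ, boolSign_true, boolSign_false,
      one_mul, neg_mul]
    have hC (i : ι) (σ : Fin n → Bool) : |∑ k, boolSign (σ k) * a i k.succ| ≤ n * C := by
      refine (Finset.abs_sum_le_sum_abs _ _).trans ?_
      refine (Finset.sum_le_card_nsmul _ _ C fun k _ => ?_).trans_eq (by simp)
      rw [abs_mul, abs_boolSign, one_mul]
      exact ha i _
    have hC0 : 0 ≤ C := (abs_nonneg _).trans (ha (Classical.arbitrary ι) 0)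
    calc _ ≤ ∑ σ : Fin n → Bool, ((⨆ i, (b i + (w i 0 + ∑ k, boolSign (σ k) * a i k.succ))) +
          ⨆ i, (b i + (-w i 0 + ∑ k, boolSign (σ k) * a i k.succ))) := by
          refine Finset.sum_le_sum fun σ _ => ?_
          have := iSup_add_iSup_neg_le (b := fun i => b i + ∑ k, boolSign (σ k) * a i k.succ)
            (a := fun i => a i 0) (w := fun i => w i 0) (C := B + n * C + C)
            (fun i => by
              refine (abs_add_le _ _).trans ?_
              linarith [hb i, hC i σ])
            (fun i => by
              have : 0 ≤ n * C := by positivity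
              linarith [(abs_nonneg _).trans (hb i), hw i 0])
            (fun i j => haw i j 0)
          refine (le_of_eq ?_).trans (this.trans_eq ?_) <;> refine congrArg₂ _ ?_ ?_ <;>
            exact iSup_congr fun i => by ring
      _ ≤ _ := by
          rw [Finset.sum_add_distrib, Finset.sum_add_distrib]
          simp only [← add_assoc]
          refine add_le_add (ih (B := B + C) (fun i => ?_) (fun i k => ha i _) (fun i k => hw i _)
            (fun i j k => haw i j _)) (ih (B := B + C) (fun i => ?_) (fun i k => ha i _)
            (fun i k => hw i _) (fun i j k => haw i j _))
          · exact (abs_add_le _ _).trans (add_le_add (hb i) (hw i 0))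
          · exact (abs_add_le _ _).trans (add_le_add (hb i) (by rw [abs_neg]; exact hw i 0))

end Signs

section Rademacher

variable {Y : Type*} [MeasurableSpace Y] {P : Measure Y} {ι : Type*} {n : ℕ} {C : ℝ}

/-- Average over all sign vectors of the supremum of the signed empirical means. -/
noncomputable def signSup (ψ : ι → Y → ℝ) (n : ℕ) (y : Fin n → Y) : ℝ :=
  (2 ^ n : ℝ)⁻¹ * ∑ σ : Fin n → Bool, ⨆ i, (n : ℝ)⁻¹ * ∑ k, boolSign (σ k) * ψ i (y k)

/-- Rademacher complexity of an indexed family of functions. -/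
noncomputable def radFam (ψ : ι → Y → ℝ) (P : Measure Y) (n : ℕ) : ℝ :=
  ∫ y, signSup ψ n y ∂(Measure.pi fun _ : Fin n => P)

lemma abs_mean_le {x : Fin n → ℝ} (hC : 0 ≤ C) (hx : ∀ k, |x k| ≤ C) :
    |(n : ℝ)⁻¹ * ∑ k, x k| ≤ C := by
  rcases Nat.eq_zero_or_pos n with rfl | hn
  · simpa using hC
  have hn' : (0 : ℝ) < n := by exact_mod_cast hn
  rw [abs_mul, abs_of_nonneg (by positivity), inv_mul_le_iff₀ hn']
  exact (Finset.abs_sum_le_sum_abs _ _).trans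
    ((Finset.sum_le_card_nsmul _ _ C fun k _ => hx k).trans_eq (by simp))

lemma abs_signed_mean_le {x : Fin n → ℝ} (hC : 0 ≤ C) (σ : Fin n → Bool) (hx : ∀ k, |x k| ≤ C) :
    |(n : ℝ)⁻¹ * ∑ k, boolSign (σ k) * x k| ≤ C :=
  abs_mean_le hC fun k => by rw [abs_mul, abs_boolSign, one_mul]; exact hx k

lemma bddAbove_of_abs_le {g : ι → ℝ} (h : ∀ i, |g i| ≤ C) : BddAbove (range g) :=
  ⟨C, by rintro _ ⟨i, rfl⟩; exact (abs_le.1 (h i)).2⟩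

variable [Nonempty ι]

lemma abs_iSup_le {g : ι → ℝ} (h : ∀ i, |g i| ≤ C) : |⨆ i, g i| ≤ C :=
  abs_le.2 ⟨(abs_le.1 (h (Classical.arbitrary ι))).1.trans (le_ciSup (bddAbove_of_abs_le h) _),
    ciSup_le fun i => (abs_le.1 (h i)).2⟩

lemma iSup_add_le_iSup_add_iSup {g g' : ι → ℝ} {C' : ℝ} (h : ∀ i, |g i| ≤ C)
    (h' : ∀ i, |g' i| ≤ C') : ⨆ i, (g i + g' i) ≤ (⨆ i, g i) + ⨆ i, g' i :=
  ciSup_le fun i => add_le_add (le_ciSup (bddAbove_of_abs_le h) i)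
    (le_ciSup (bddAbove_of_abs_le h') i)

lemma integrable_iSup [Countable ι] {W : Type*} [MeasurableSpace W] {μ : Measure W}
    [IsFiniteMeasure μ] {g : ι → W → ℝ} (hg : ∀ i, Measurable (g i)) (h : ∀ i w, |g i w| ≤ C) :
    Integrable (fun w => ⨆ i, g i w) μ :=
  Integrable.of_bound (Measurable.iSup hg).aestronglyMeasurable C
    (ae_of_all _ fun w => abs_iSup_le fun i => h i w)

lemma measurable_signed_mean {ψ : Y → ℝ} (hψ : Measurable ψ) (σ : Fin n → Bool) :
    Measurable fun y : Fin n → Y => (n : ℝ)⁻¹ * ∑ k, boolSign (σ k) * ψ (y k) := by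
  fun_prop

variable [IsProbabilityMeasure P]

lemma integrable_signed_iSup [Countable ι] {ψ : ι → Y → ℝ} (hC : 0 ≤ C)
    (hψ : ∀ i, Measurable (ψ i)) (hψC : ∀ i y, |ψ i y| ≤ C) (σ : Fin n → Bool) :
    Integrable (fun y : Fin n → Y => ⨆ i, (n : ℝ)⁻¹ * ∑ k, boolSign (σ k) * ψ i (y k))
      (Measure.pi fun _ : Fin n => P) :=
  integrable_iSup (fun i => measurable_signed_mean (hψ i) σ)
    fun _ _ => abs_signed_mean_le hC σ fun _ => hψC _ _

lemma integrable_signSup [Countable ι] {ψ : ι → Y → ℝ} (hC : 0 ≤ C)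
    (hψ : ∀ i, Measurable (ψ i)) (hψC : ∀ i y, |ψ i y| ≤ C) :
    Integrable (signSup ψ n) (Measure.pi fun _ : Fin n => P) :=
  (integrable_finsetSum _ fun σ _ => integrable_signed_iSup hC hψ hψC σ).const_mul _

lemma radFam_eq_sum [Countable ι] {ψ : ι → Y → ℝ} (hC : 0 ≤ C)
    (hψ : ∀ i, Measurable (ψ i)) (hψC : ∀ i y, |ψ i y| ≤ C) :
    radFam ψ P n = (2 ^ n : ℝ)⁻¹ * ∑ σ : Fin n → Bool,
      ∫ y, ⨆ i, (n : ℝ)⁻¹ * ∑ k, boolSign (σ k) * ψ i (y k) ∂(Measure.pi fun _ : Fin n => P) := by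
  simp only [radFam, signSup]
  rw [integral_const_mul, integral_finsetSum _ fun σ _ => integrable_signed_iSup hC hψ hψC σ]

omit [MeasurableSpace Y] [Nonempty ι] in
lemma signSup_neg (ψ : ι → Y → ℝ) (y : Fin n → Y) :
    signSup (fun i y => -ψ i y) n y = signSup ψ n y := by
  rw [signSup, signSup, ← sum_signs_not]
  simp [boolSign_not]

omit [Nonempty ι] [IsProbabilityMeasure P] in
lemma radFam_neg (ψ : ι → Y → ℝ) : radFam (fun i y => -ψ i y) P n = radFam ψ P n := by
  simp only [radFam, signSup_neg]

omit [MeasurableSpace Y] in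
lemma signSup_nonneg {ψ : ι → Y → ℝ} (hC : 0 ≤ C) (hψC : ∀ i y, |ψ i y| ≤ C) (y : Fin n → Y) :
    0 ≤ signSup ψ n y := by
  refine mul_nonneg (by positivity) ?_
  have h0 : ∑ σ : Fin n → Bool, (n : ℝ)⁻¹ *
      ∑ k, boolSign (σ k) * ψ (Classical.arbitrary ι) (y k) = 0 := by
    have := sum_signs_not fun σ : Fin n → Bool => (n : ℝ)⁻¹ *
      ∑ k, boolSign (σ k) * ψ (Classical.arbitrary ι) (y k)
    simp only [boolSign_not, neg_mul, Finset.sum_neg_distrib, mul_neg] at this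
    linarith
  rw [← h0]
  exact Finset.sum_le_sum fun σ _ => le_ciSup
    (bddAbove_of_abs_le fun i => abs_signed_mean_le hC σ fun k => hψC i (y k)) _

omit [IsProbabilityMeasure P] in
lemma radFam_nonneg {ψ : ι → Y → ℝ} (hC : 0 ≤ C) (hψC : ∀ i y, |ψ i y| ≤ C) :
    0 ≤ radFam ψ P n :=
  integral_nonneg (signSup_nonneg hC hψC)

omit [MeasurableSpace Y] in
lemma signSup_le_of_abs_sub_le {ψ w : ι → Y → ℝ} (hψC : ∀ i y, |ψ i y| ≤ C)
    (hwC : ∀ i y, |w i y| ≤ C) (hψw : ∀ i j y, |ψ i y - ψ j y| ≤ |w i y - w j y|)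
    (y : Fin n → Y) : signSup ψ n y ≤ signSup w n y := by
  refine mul_le_mul_of_nonneg_left ?_ (by positivity)
  have := sum_signs_contraction n (ι := ι) (b := fun _ => 0) (B := 0) (C := (n : ℝ)⁻¹ * C)
    (a := fun i k => (n : ℝ)⁻¹ * ψ i (y k)) (w := fun i k => (n : ℝ)⁻¹ * w i (y k)) (by simp)
    (fun i k => ?_) (fun i k => ?_) fun i j k => ?_
  · simpa [Finset.mul_sum, mul_left_comm] using this
  · rw [abs_mul, abs_of_nonneg (by positivity)]; gcongr; exact hψC _ _
  · rw [abs_mul, abs_of_nonneg (by positivity)]; gcongr; exact hwC _ _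
  · rw [← mul_sub, ← mul_sub, abs_mul, abs_mul]; exact mul_le_mul_of_nonneg_left (hψw _ _ _) (abs_nonneg _)

omit [MeasurableSpace Y] in
lemma signSup_mul_add_const_le {κ : Type*} [Nonempty κ] {u : ι → Y → ℝ} {c : κ → ℝ}
    {L s : ℝ} (hC : 0 ≤ C) (hL : 0 ≤ L) (huC : ∀ i y, |u i y| ≤ C) (hc : ∀ ν, |c ν| ≤ s)
    (y : Fin n → Y) :
    signSup (fun (p : ι × κ) y => L * (u p.1 y + c p.2)) n y ≤
      L * (signSup u n y + s / √n) := by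
  have hs : 0 ≤ s := (abs_nonneg _).trans (hc (Classical.arbitrary κ))
  have hpt (σ : Fin n → Bool) : (⨆ p : ι × κ, (n : ℝ)⁻¹ *
      ∑ k, boolSign (σ k) * (L * (u p.1 (y k) + c p.2))) ≤
      L * ((⨆ i, (n : ℝ)⁻¹ * ∑ k, boolSign (σ k) * u i (y k)) +
        s * ((n : ℝ)⁻¹ * |∑ k, boolSign (σ k)|)) := by
    refine ciSup_le fun p => ?_
    have h1 := le_ciSup (bddAbove_of_abs_le
      fun i => abs_signed_mean_le hC σ fun k => huC i (y k)) p.1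
    have h2 : c p.2 * ((n : ℝ)⁻¹ * ∑ k, boolSign (σ k)) ≤
        s * ((n : ℝ)⁻¹ * |∑ k, boolSign (σ k)|) := by
      refine (le_abs_self _).trans ?_
      rw [abs_mul, abs_mul, abs_of_nonneg (by positivity : (0 : ℝ) ≤ (n : ℝ)⁻¹)]
      gcongr
      exact hc _
    calc _ = L * ((n : ℝ)⁻¹ * ∑ k, boolSign (σ k) * u p.1 (y k) +
          c p.2 * ((n : ℝ)⁻¹ * ∑ k, boolSign (σ k))) := by
          simp only [Finset.mul_sum, ← Finset.sum_add_distrib]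
          exact Finset.sum_congr rfl fun k _ => by ring
      _ ≤ _ := by gcongr
  have hsum := sum_signs_abs_le n
  calc _ ≤ (2 ^ n : ℝ)⁻¹ * ∑ σ : Fin n → Bool,
        L * ((⨆ i, (n : ℝ)⁻¹ * ∑ k, boolSign (σ k) * u i (y k)) +
          s * ((n : ℝ)⁻¹ * |∑ k, boolSign (σ k)|)) := by
        unfold signSup
        gcongr with σ
        exact hpt σ
    _ = L * (signSup u n y +
        s * ((n : ℝ)⁻¹ * ((2 ^ n : ℝ)⁻¹ * ∑ σ : Fin n → Bool, |∑ k, boolSign (σ k)|))) := by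
        rw [← Finset.mul_sum, Finset.sum_add_distrib, ← Finset.mul_sum, ← Finset.mul_sum, signSup]
        ring
    _ ≤ L * (signSup u n y + s * ((n : ℝ)⁻¹ * ((2 ^ n : ℝ)⁻¹ * (2 ^ n * √n)))) := by gcongr
    _ = _ := by
        rw [inv_mul_cancel_left₀ (by positivity), div_eq_mul_inv]
        rcases Nat.eq_zero_or_pos n with rfl | hn
        · simp
        have hn' : (0 : ℝ) < n := by exact_mod_cast hn
        have : (n : ℝ)⁻¹ * √n = (√n)⁻¹ := by
          rw [inv_mul_eq_div, Real.sqrt_div_self', one_div]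
        rw [this]

end Rademacher

lemma MeasureTheory.MeasurePreserving.integral_comp_measurable_real {V W : Type*}
    [MeasurableSpace V] [MeasurableSpace W] {μ : Measure V} {ν : Measure W} {T : V → W}
    (hT : MeasurePreserving T μ ν) {g : W → ℝ} (hg : Measurable g) :
    ∫ w, g w ∂ν = ∫ v, g (T v) ∂μ := by
  rw [← hT.map_eq, integral_map hT.aemeasurable hg.aestronglyMeasurable]

section Symmetrization

variable {Y : Type*} [MeasurableSpace Y] {P : Measure Y} [IsProbabilityMeasure P]
  {ι : Type*} [Nonempty ι] [Countable ι] {n : ℕ} {C : ℝ} {ψ : ι → Y → ℝ}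

/-- The supremum over the family of the signed empirical means of differences over pairs. -/
noncomputable def pairSup (ψ : ι → Y → ℝ) (σ : Fin n → Bool) (w : Fin n → Y × Y) : ℝ :=
  ⨆ i, (n : ℝ)⁻¹ * ∑ k, boolSign (σ k) * (ψ i (w k).1 - ψ i (w k).2)

omit [MeasurableSpace Y] [Nonempty ι] [Countable ι] in
lemma abs_pairSup_aux (hC : 0 ≤ C) (hψC : ∀ i y, |ψ i y| ≤ C) (σ : Fin n → Bool) (i : ι)
    (w : Fin n → Y × Y) :
    |(n : ℝ)⁻¹ * ∑ k, boolSign (σ k) * (ψ i (w k).1 - ψ i (w k).2)| ≤ C + C :=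
  abs_signed_mean_le (by positivity) σ fun _ =>
    (abs_sub _ _).trans (add_le_add (hψC _ _) (hψC _ _))

omit [Nonempty ι] in
lemma measurable_pairSup (hψ : ∀ i, Measurable (ψ i)) (σ : Fin n → Bool) :
    Measurable (pairSup ψ σ) :=
  Measurable.iSup fun i => by have := hψ i; fun_prop

omit [Nonempty ι] in
lemma integral_pairSup_eq (hψ : ∀ i, Measurable (ψ i)) (σ : Fin n → Bool) :
    ∫ w, pairSup ψ σ w ∂(Measure.pi fun _ : Fin n => P.prod P) =
      ∫ w, pairSup ψ (fun _ => true) w ∂(Measure.pi fun _ : Fin n => P.prod P) := by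
  have hT : MeasurePreserving
      (fun (w : Fin n → Y × Y) k => (if σ k then id else Prod.swap : Y × Y → Y × Y) (w k))
      (Measure.pi fun _ : Fin n => P.prod P) (Measure.pi fun _ : Fin n => P.prod P) := by
    refine measurePreserving_pi _ _ fun k => ?_
    split_ifs
    · exact MeasurePreserving.id _
    · exact Measure.measurePreserving_swap
  rw [← hT.map_eq, integral_map hT.aemeasurable
    (measurable_pairSup hψ _).aestronglyMeasurable, hT.map_eq]
  refine integral_congr_ae (ae_of_all _ fun w => ?_)
  refine iSup_congr fun i => ?_
  congr 1
  refine Finset.sum_congr rfl fun k _ => ?_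
  cases h : σ k <;> simp [h]

lemma integral_pairSup_le (hC : 0 ≤ C) (hψ : ∀ i, Measurable (ψ i)) (hψC : ∀ i y, |ψ i y| ≤ C) :
    ∫ w, pairSup ψ (fun _ => true) w ∂(Measure.pi fun _ : Fin n => P.prod P) ≤
      2 * radFam ψ P n := by
  set A : (Fin n → Bool) → ℝ := fun σ =>
    ∫ y, ⨆ i, (n : ℝ)⁻¹ * ∑ k, boolSign (σ k) * ψ i (y k) ∂(Measure.pi fun _ : Fin n => P)
    with hA
  have h1 : MeasurePreserving (fun (w : Fin n → Y × Y) k => (w k).1)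
      (Measure.pi fun _ : Fin n => P.prod P) (Measure.pi fun _ : Fin n => P) :=
    measurePreserving_pi _ _ fun _ => measurePreserving_fst
  have h2 : MeasurePreserving (fun (w : Fin n → Y × Y) k => (w k).2)
      (Measure.pi fun _ : Fin n => P.prod P) (Measure.pi fun _ : Fin n => P) :=
    measurePreserving_pi _ _ fun _ => measurePreserving_snd
  have hle (σ : Fin n → Bool) :
      ∫ w, pairSup ψ (fun _ => true) w ∂(Measure.pi fun _ : Fin n => P.prod P) ≤
        A σ + A fun k => !(σ k) := by
    have hi (τ : Fin n → Bool) := integrable_signed_iSup (P := P) hC hψ hψC τ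
    have e1 : A σ = _ := h1.integral_comp_measurable_real
      (Measurable.iSup fun i => measurable_signed_mean (hψ i) σ)
    have e2 : A (fun k => !(σ k)) = _ := h2.integral_comp_measurable_real
      (Measurable.iSup fun i => measurable_signed_mean (hψ i) fun k => !(σ k))
    have i1 := (h1.integrable_comp (hi σ).aestronglyMeasurable).2 (hi σ)
    have i2 := (h2.integrable_comp (hi fun k => !(σ k)).aestronglyMeasurable).2
      (hi fun k => !(σ k))
    rw [← integral_pairSup_eq hψ σ, e1, e2]
    refine le_trans ?_ (integral_add i1 i2).le
    refine integral_mono (integrable_iSup (C := C + C) (fun i => by have := hψ i; fun_prop)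
      fun i w => abs_pairSup_aux hC hψC σ i w) (i1.add i2) fun w => ?_
    refine (le_of_eq ?_).trans (iSup_add_le_iSup_add_iSup
      (fun i => abs_signed_mean_le hC σ fun _ => hψC i _)
      fun i => abs_signed_mean_le hC (fun k => !(σ k)) fun _ => hψC i _)
    refine iSup_congr fun i => ?_
    rw [← mul_add, ← Finset.sum_add_distrib]
    simp only [boolSign_not, neg_mul, ← sub_eq_add_neg, mul_sub]
  have hsum := Finset.sum_le_sum fun (σ : Fin n → Bool) (_ : σ ∈ Finset.univ) => hle σ
  rw [Finset.sum_add_distrib, sum_signs_not A] at hsum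
  simp only [Finset.sum_const, Finset.card_univ, Fintype.card_pi, Fintype.card_bool,
    Finset.prod_const, Fintype.card_fin, nsmul_eq_mul] at hsum
  rw [radFam_eq_sum hC hψ hψC]
  push_cast at hsum
  have h2n : (0 : ℝ) < 2 ^ n := by positivity
  rw [← mul_le_mul_iff_right₀ h2n]
  refine hsum.trans_eq ?_
  rw [mul_left_comm, mul_inv_cancel_left₀ h2n.ne', two_mul]

lemma integral_iSup_sub_mean_le [NeZero n] (hC : 0 ≤ C) (hψ : ∀ i, Measurable (ψ i))
    (hψC : ∀ i y, |ψ i y| ≤ C) :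
    ∫ y, ⨆ i, (∫ x, ψ i x ∂P - (n : ℝ)⁻¹ * ∑ k, ψ i (y k)) ∂(Measure.pi fun _ : Fin n => P) ≤
      2 * radFam ψ P n := by
  refine le_trans ?_ (integral_pairSup_le hC hψ hψC)
  set π := Measure.pi fun _ : Fin n => P with hπ
  have hn : (0 : ℝ) < n := by exact_mod_cast NeZero.pos n
  set G : (Fin n → Y) × (Fin n → Y) → ℝ := fun p =>
    ⨆ i, (n : ℝ)⁻¹ * ∑ k, (ψ i (p.1 k) - ψ i (p.2 k)) with hG
  have hGb (i : ι) (p : (Fin n → Y) × (Fin n → Y)) :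
      |(n : ℝ)⁻¹ * ∑ k, (ψ i (p.1 k) - ψ i (p.2 k))| ≤ C + C :=
    abs_mean_le (by positivity) fun _ => (abs_sub _ _).trans (add_le_add (hψC _ _) (hψC _ _))
  have hGi : Integrable G (π.prod π) :=
    integrable_iSup (fun i => by have := hψ i; fun_prop) hGb
  have hGe : ∫ w, pairSup ψ (fun _ => true) w ∂(Measure.pi fun _ : Fin n => P.prod P) =
      ∫ p, G p ∂(π.prod π) := by
    rw [← (measurePreserving_arrowProdEquivProdArrow Y Y (Fin n) (fun _ => P)
      (fun _ => P)).integral_comp' G]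
    simp [pairSup, hG, MeasurableEquiv.arrowProdEquivProdArrow, Equiv.arrowProdEquivProdArrow]
  have hmean (i : ι) : ∫ y, (n : ℝ)⁻¹ * ∑ k, ψ i (y k) ∂π = ∫ x, ψ i x ∂P := by
    have hint (k : Fin n) : Integrable (fun y : Fin n → Y => ψ i (y k)) π :=
      Integrable.of_bound ((hψ i).comp (measurable_pi_apply k)).aestronglyMeasurable C
        (ae_of_all _ fun _ => hψC i _)
    rw [integral_const_mul, integral_finsetSum _ fun k _ => hint k]
    have (k : Fin n) : ∫ y, ψ i (y k) ∂π = ∫ x, ψ i x ∂P :=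
      ((measurePreserving_eval (fun _ : Fin n => P) k).integral_comp_measurable_real (hψ i)).symm
    simp [this, hn.ne']
  have hmi (i : ι) : Integrable (fun y : Fin n → Y => (n : ℝ)⁻¹ * ∑ k, ψ i (y k)) π :=
    Integrable.of_bound (Measurable.aestronglyMeasurable (by have := hψ i; fun_prop)) C
      (ae_of_all _ fun y => abs_mean_le hC fun k => hψC i _)
  rw [hGe, integral_prod_symm _ hGi]
  refine integral_mono (integrable_iSup (C := C + C) (fun i => by have := hψ i; fun_prop)
    fun i y => ?_) hGi.integral_prod_right fun y => ?_
  · refine (abs_sub _ _).trans (add_le_add ?_ (abs_mean_le hC fun k => hψC i _))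
    rw [← hmean i]
    exact abs_integral_le_of_abs_le fun y => abs_mean_le hC fun k => hψC i _
  · refine ciSup_le fun i => ?_
    have : ∫ x, ψ i x ∂P - (n : ℝ)⁻¹ * ∑ k, ψ i (y k) =
        ∫ y', (n : ℝ)⁻¹ * ∑ k, (ψ i (y' k) - ψ i (y k)) ∂π := by
      simp only [Finset.sum_sub_distrib, mul_sub]
      rw [integral_sub (hmi i) (integrable_const _), hmean i]
      simp
    rw [this]
    refine integral_mono (Integrable.of_bound
      (Measurable.aestronglyMeasurable (by have := hψ i; fun_prop)) (C + C)
      (ae_of_all _ fun y' => hGb i (y', y))) ?_ fun y' =>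
        le_ciSup (bddAbove_of_abs_le fun i => hGb i (y', y)) i
    exact integrable_iSup (fun i => by have := hψ i; fun_prop) fun i y' => hGb i (y', y)

lemma integral_iSup_mean_sub_le [NeZero n] (hC : 0 ≤ C) (hψ : ∀ i, Measurable (ψ i))
    (hψC : ∀ i y, |ψ i y| ≤ C) :
    ∫ y, ⨆ i, ((n : ℝ)⁻¹ * ∑ k, ψ i (y k) - ∫ x, ψ i x ∂P) ∂(Measure.pi fun _ : Fin n => P) ≤
      2 * radFam ψ P n := by
  have := integral_iSup_sub_mean_le (P := P) (n := n) (ψ := fun i y => -ψ i y) hC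
    (fun i => (hψ i).neg) fun i y => by rw [abs_neg]; exact hψC i y
  rw [radFam_neg] at this
  simpa [integral_neg, neg_add_eq_sub] using this

end Symmetrization

section Deviation

variable {Y : Type*} [MeasurableSpace Y] {P : Measure Y} [IsProbabilityMeasure P]
  {ι : Type*} [Nonempty ι] [Countable ι] {n : ℕ} [NeZero n] {s : ℝ}

lemma integral_iSup_signed_dev_le {C : ℝ} {ψ : ι → Y → ℝ} (hs : s = 1 ∨ s = -1)
    (hψ : ∀ i, Measurable (ψ i)) (hψC : ∀ i y, |ψ i y| ≤ C) :
    ∫ y, ⨆ i, s * (∫ x, ψ i x ∂(empMeas n y) - ∫ x, ψ i x ∂P) ∂(Measure.pi fun _ : Fin n => P) ≤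
      2 * radFam ψ P n := by
  have hC : 0 ≤ C := by
    have : Nonempty Y := nonempty_of_isProbabilityMeasure P
    exact (abs_nonneg _).trans (hψC (Classical.arbitrary ι) (Classical.arbitrary Y))
  have he (i : ι) (y : Fin n → Y) := integral_empMeas y (hψ i)
  simp only [he]
  rcases hs with rfl | rfl
  · simpa using integral_iSup_mean_sub_le (P := P) (n := n) hC hψ hψC
  · simpa using integral_iSup_sub_mean_le (P := P) (n := n) hC hψ hψC

variable {φ : ℝ → ℝ} {z₀ r M α β : ℝ} {u : ι → Y → ℝ} {D : Set ℝ}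

lemma integrable_signed_dev {C : ℝ} {ψ : ι → Y → ℝ} (hs : s = 1 ∨ s = -1)
    (hψ : ∀ i, Measurable (ψ i)) (hψC : ∀ i y, |ψ i y| ≤ C) :
    Integrable (fun y => ⨆ i, s * (∫ x, ψ i x ∂(empMeas n y) - ∫ x, ψ i x ∂P))
      (Measure.pi fun _ : Fin n => P) := by
  refine integrable_iSup (C := C + C) (fun i => ?_) fun i y => ?_
  · have := hψ i
    simp only [integral_empMeas _ (hψ i)]
    fun_prop
  · have : |s| = 1 := by rcases hs with rfl | rfl <;> simp
    rw [abs_mul, this, one_mul]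
    exact (abs_sub _ _).trans
      (add_le_add (abs_integral_le_of_abs_le (hψC i)) (abs_integral_le_of_abs_le (hψC i)))

omit [NeZero n] in
lemma radFam_comp_sub_le {g : ℝ → ℝ} {L : ℝ} (hαβ : α ≤ β) (hr : r = β - α) (hg : Measurable g)
    (hL : 0 ≤ L)
    (hgL : ∀ x ∈ Icc (z₀ - r) (z₀ + r), ∀ y ∈ Icc (z₀ - r) (z₀ + r), |g x - g y| ≤ L * |x - y|)
    (hu : ∀ i, Measurable (u i)) (hub : ∀ i y, u i y ∈ Icc α β)
    (hDJ : D ⊆ Icc (α - z₀) (β - z₀)) (hDc : D.Countable) (hDn : D.Nonempty) :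
    radFam (fun (p : ι × D) y => g (u p.1 y - p.2)) P n ≤
      L * (radFam u P n + r / (2 * √n)) := by
  have := hDc.to_subtype
  have := hDn.to_subtype
  have hmem (p : ι × D) (y : Y) : u p.1 y - p.2 ∈ Icc (z₀ - r) (z₀ + r) :=
    TangentConvex.sub_mem hr (hub p.1 y) (hDJ p.2.2)
  have hz : z₀ ∈ Icc (z₀ - r) (z₀ + r) := ⟨by linarith, by linarith⟩
  have hgC (p : ι × D) (y : Y) : |g (u p.1 y - p.2)| ≤ |g z₀| + L * r := by
    have h1 := hgL _ (hmem p y) _ hz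
    have h2 : |u p.1 y - p.2 - z₀| ≤ r :=
      abs_le.2 ⟨by linarith [(hmem p y).1], by linarith [(hmem p y).2]⟩
    have h3 := mul_le_mul_of_nonneg_left h2 hL
    have h4 := abs_sub_abs_le_abs_sub (g (u p.1 y - p.2)) (g z₀)
    linarith
  set c : D → ℝ := fun ν => (α + β) / 2 - z₀ - ν with hc
  have hcs (ν : D) : |c ν| ≤ r / 2 := by
    have := hDJ ν.2
    exact abs_le.2 ⟨by simp only [hc]; linarith [this.2], by simp only [hc]; linarith [this.1]⟩
  have huC (i : ι) (y : Y) : |u i y| ≤ max |α| |β| :=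
    abs_le_max_abs_abs (hub i y).1 (hub i y).2
  have hC : 0 ≤ max |α| |β| := (abs_nonneg _).trans (le_max_left _ _)
  have hwC (p : ι × D) (y : Y) : |L * (u p.1 y + c p.2)| ≤ L * (max |α| |β| + r / 2) := by
    rw [abs_mul, abs_of_nonneg hL]
    gcongr
    exact (abs_add_le _ _).trans (add_le_add (huC _ _) (hcs _))
  have hr0 : 0 ≤ r := by linarith
  have key (y : Fin n → Y) : signSup (fun (p : ι × D) y => g (u p.1 y - p.2)) n y ≤
      L * (signSup u n y + r / (2 * √n)) := by
    refine (signSup_le_of_abs_sub_le (w := fun (p : ι × D) y => L * (u p.1 y + c p.2))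
      (C := max (|g z₀| + L * r) (L * (max |α| |β| + r / 2)))
      (fun p y => (hgC p y).trans (le_max_left _ _)) (fun p y => (hwC p y).trans (le_max_right _ _))
      (fun p q y => ?_) y).trans ((signSup_mul_add_const_le hC hL huC hcs y).trans_eq ?_)
    · refine (hgL _ (hmem p y) _ (hmem q y)).trans_eq ?_
      rw [← mul_sub, abs_mul, abs_of_nonneg hL]
      simp only [hc]
      ring_nf
    · rw [div_div]
  have hi := integrable_signSup (P := P) (n := n) hC hu huC
  calc _ ≤ ∫ y, L * (signSup u n y + r / (2 * √n)) ∂(Measure.pi fun _ : Fin n => P) := by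
        refine integral_mono (integrable_signSup (C := |g z₀| + L * r) (by positivity)
          (fun p => hg.comp ((hu p.1).sub_const _)) hgC) ?_ key
        exact (hi.add (integrable_const _)).const_mul _
    _ = _ := by
        rw [integral_const_mul, integral_add hi (integrable_const _)]
        simp [radFam]

/-- Uniform deviation of the shifted functional between a measure and its empirical version. -/
noncomputable def shiftDev (φ : ℝ → ℝ) (J : Set ℝ) (P : Measure Y) (u : ι → Y → ℝ) (s : ℝ)
    (y : Fin n → Y) : ℝ :=
  ⨆ i, s * (shiftInf φ J (empMeas n y) (u i) - shiftInf φ J P (u i))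

namespace TangentConvex

lemma signed_dev_le (h : TangentConvex φ z₀ r M) (hr : r = β - α) (hφ : Measurable φ)
    {μ ν : Measure Y} [IsProbabilityMeasure μ] [IsProbabilityMeasure ν] {v : Y → ℝ}
    (hv : Measurable v) (hvb : ∀ y, v y ∈ Icc α β) {D : Set ℝ}
    (hDJ : D ⊆ Icc (α - z₀) (β - z₀)) (hDn : D.Nonempty) {B : ℝ}
    (hμ : shiftInf φ (Icc (α - z₀) (β - z₀)) μ v = shiftInf φ D μ v)
    (hB : ∀ t ∈ D, ∫ y, φ (v y - t) ∂ν - ∫ y, φ (v y - t) ∂μ ≤ B) :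
    shiftInf φ (Icc (α - z₀) (β - z₀)) ν v - shiftInf φ (Icc (α - z₀) (β - z₀)) μ v ≤ B := by
  have := hDn.to_subtype
  rw [hμ, sub_le_comm]
  refine le_ciInf fun t => ?_
  have := h.shiftInf_le (P := ν) hr hφ hv hvb (hDJ t.2)
  linarith [hB t t.2]

lemma abs_shiftInf_sub_le (h : TangentConvex φ z₀ r M) (hr : r = β - α) (hφ : Measurable φ)
    {μ ν : Measure Y} [IsProbabilityMeasure μ] [IsProbabilityMeasure ν] {v w : Y → ℝ}
    (hv : Measurable v) (hvb : ∀ y, v y ∈ Icc α β) (hw : Measurable w)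
    (hwb : ∀ y, w y ∈ Icc α β) (hs : s = 1 ∨ s = -1) :
    |s * (shiftInf φ (Icc (α - z₀) (β - z₀)) μ v - shiftInf φ (Icc (α - z₀) (β - z₀)) ν w)| ≤ r := by
  have : |s| = 1 := by rcases hs with rfl | rfl <;> simp
  rw [abs_mul, this, one_mul, hr]
  have h1 := h.shiftInf_mem (P := μ) hr hφ hv hvb
  have h2 := h.shiftInf_mem (P := ν) hr hφ hw hwb
  exact abs_le.2 ⟨by linarith [h1.1, h2.2], by linarith [h1.2, h2.1]⟩

omit [IsProbabilityMeasure P] [Nonempty ι] in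
lemma measurable_shiftDev (h : TangentConvex φ z₀ r M) (hr : r = β - α) (hφ : Measurable φ)
    (hu : ∀ i, Measurable (u i)) (hub : ∀ i y, u i y ∈ Icc α β) (s : ℝ) :
    Measurable (shiftDev (n := n) φ (Icc (α - z₀) (β - z₀)) P u s) := by
  obtain ⟨D, hDJ, hDc, hDn, hD⟩ := h.exists_countable_shiftInf_eq hr hφ
  refine Measurable.iSup fun i => Measurable.const_mul (Measurable.sub_const ?_ _) s
  rw [funext fun y : Fin n → Y => hD (empMeas n y) (u i) (hu i) (hub i)]
  exact measurable_shiftInf_empMeas hDc hφ (hu i) n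

omit [Countable ι] in
lemma abs_shiftDev_le (h : TangentConvex φ z₀ r M) (hr : r = β - α) (hφ : Measurable φ)
    (hu : ∀ i, Measurable (u i)) (hub : ∀ i y, u i y ∈ Icc α β) (hs : s = 1 ∨ s = -1)
    (y : Fin n → Y) :
    |shiftDev φ (Icc (α - z₀) (β - z₀)) P u s y| ≤ r :=
  abs_iSup_le fun i => h.abs_shiftInf_sub_le hr hφ (hu i) (hub i) (hu i) (hub i) hs

lemma integral_shiftDev_le (h : TangentConvex φ z₀ r M) (hr : r = β - α) (hφ : Measurable φ)
    (hu : ∀ i, Measurable (u i)) (hub : ∀ i y, u i y ∈ Icc α β) (hs : s = 1 ∨ s = -1)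
    {l L : ℝ} (hl : 0 ≤ l) (hL : 0 ≤ L)
    (hgL : ∀ x ∈ Icc (z₀ - r) (z₀ + r), ∀ y ∈ Icc (z₀ - r) (z₀ + r),
      |(φ x - l * x) - (φ y - l * y)| ≤ L * |x - y|) :
    ∫ y, shiftDev (n := n) φ (Icc (α - z₀) (β - z₀)) P u s y ∂(Measure.pi fun _ : Fin n => P) ≤
      2 * (l * radFam u P n + L * (radFam u P n + r / (2 * √n))) := by
  obtain ⟨D, hDJ, hDc, hDn, hD⟩ := h.exists_countable_shiftInf_eq hr hφ
  have := hDc.to_subtype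
  have := hDn.to_subtype
  have hαβ : α ≤ β := by linarith [h.pos]
  set g : ℝ → ℝ := fun x => φ x - l * x with hg
  have hgm : Measurable g := hφ.sub (measurable_id.const_mul l)
  set ψ : ι × D → Y → ℝ := fun p y => g (u p.1 y - p.2) with hψ
  have huC (i : ι) (y : Y) : |u i y| ≤ max |α| |β| :=
    abs_le_max_abs_abs (hub i y).1 (hub i y).2
  have hψm (p : ι × D) : Measurable (ψ p) := hgm.comp ((hu p.1).sub_const _)
  have hmem (p : ι × D) (y : Y) : u p.1 y - p.2 ∈ Icc (z₀ - r) (z₀ + r) :=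
    sub_mem hr (hub p.1 y) (hDJ p.2.2)
  have hψC (p : ι × D) (y : Y) : |ψ p y| ≤ (|z₀| + M * r) + l * (|z₀| + r) := by
    refine (abs_sub _ _).trans (add_le_add (h.abs_le_bound (hmem p y)) ?_)
    rw [abs_mul, abs_of_nonneg hl]
    gcongr
    have h1 : |u p.1 y - p.2 - z₀| ≤ r :=
      abs_le.2 ⟨by linarith [(hmem p y).1], by linarith [(hmem p y).2]⟩
    linarith [abs_sub_abs_le_abs_sub (u p.1 y - p.2) z₀]
  have hs1 : |s| = 1 := by rcases hs with rfl | rfl <;> simp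
  have hdecomp (ρ : Measure Y) [IsProbabilityMeasure ρ] (p : ι × D) :
      ∫ x, φ (u p.1 x - p.2) ∂ρ = l * ∫ x, u p.1 x ∂ρ - l * p.2 + ∫ x, ψ p x ∂ρ := by
    have i1 : Integrable (u p.1) ρ := integrable_of_mem (hu p.1) (hub p.1)
    have i2 : Integrable (ψ p) ρ :=
      Integrable.of_bound (hψm p).aestronglyMeasurable _ (ae_of_all _ (hψC p))
    have : (fun x => φ (u p.1 x - p.2)) = fun x => (l * u p.1 x - l * p.2) + ψ p x := by
      funext x; simp only [hψ, hg]; ring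
    have i3 : Integrable (fun x => l * u p.1 x - l * p.2) ρ :=
      (i1.const_mul l).sub (integrable_const _)
    rw [this, integral_add i3 i2, integral_sub (i1.const_mul l) (integrable_const _),
      integral_const_mul]
    simp
  have hpt (y : Fin n → Y) : shiftDev φ (Icc (α - z₀) (β - z₀)) P u s y ≤
      l * (⨆ i, s * (∫ x, u i x ∂(empMeas n y) - ∫ x, u i x ∂P)) +
        ⨆ p, s * (∫ x, ψ p x ∂(empMeas n y) - ∫ x, ψ p x ∂P) := by
    have hb1 := bddAbove_of_abs_le (g := fun i => s * (∫ x, u i x ∂(empMeas n y) - ∫ x, u i x ∂P))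
      (C := max |α| |β| + max |α| |β|) fun i => by
        rw [abs_mul, hs1, one_mul]
        exact (abs_sub _ _).trans
          (add_le_add (abs_integral_le_of_abs_le (huC i)) (abs_integral_le_of_abs_le (huC i)))
    have hb2 := bddAbove_of_abs_le (g := fun p => s * (∫ x, ψ p x ∂(empMeas n y) - ∫ x, ψ p x ∂P))
      (C := ((|z₀| + M * r) + l * (|z₀| + r)) + ((|z₀| + M * r) + l * (|z₀| + r))) fun p => by
        rw [abs_mul, hs1, one_mul]
        exact (abs_sub _ _).trans
          (add_le_add (abs_integral_le_of_abs_le (hψC p)) (abs_integral_le_of_abs_le (hψC p)))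
    refine ciSup_le fun i => ?_
    have hB (t : ℝ) (ht : t ∈ D) :
        s * (∫ x, φ (u i x - t) ∂(empMeas n y) - ∫ x, φ (u i x - t) ∂P) ≤
          l * (⨆ i, s * (∫ x, u i x ∂(empMeas n y) - ∫ x, u i x ∂P)) +
            ⨆ p, s * (∫ x, ψ p x ∂(empMeas n y) - ∫ x, ψ p x ∂P) := by
      have e1 := hdecomp (empMeas n y) (i, ⟨t, ht⟩)
      have e2 := hdecomp P (i, ⟨t, ht⟩)
      have l1 := mul_le_mul_of_nonneg_left (le_ciSup hb1 i) hl
      have l2 := le_ciSup hb2 (i, ⟨t, ht⟩)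
      simp only at e1 e2 l1 l2
      rw [e1, e2]
      refine (le_of_eq ?_).trans (add_le_add l1 l2)
      ring
    rcases hs with rfl | rfl
    · rw [one_mul]
      exact h.signed_dev_le hr hφ (hu i) (hub i) hDJ hDn (hD P (u i) (hu i) (hub i))
        fun t ht => by simpa using hB t ht
    · rw [neg_one_mul, neg_sub]
      exact h.signed_dev_le hr hφ (hu i) (hub i) hDJ hDn (hD (empMeas n y) (u i) (hu i) (hub i))
        fun t ht => by simpa using hB t ht
  have i1 := integrable_signed_dev (P := P) (n := n) hs hu huC
  have i2 := integrable_signed_dev (P := P) (n := n) hs hψm hψC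
  have hI := integral_mono (μ := Measure.pi fun _ : Fin n => P) (Integrable.of_bound
    (h.measurable_shiftDev (P := P) (n := n) hr hφ hu hub s).aestronglyMeasurable r
      (ae_of_all _ (h.abs_shiftDev_le hr hφ hu hub hs))) ((i1.const_mul l).add i2) hpt
  refine hI.trans ?_
  rw [integral_add' (i1.const_mul l) i2, integral_const_mul]
  have l1 := mul_le_mul_of_nonneg_left
    (integral_iSup_signed_dev_le (P := P) (n := n) hs hu huC) hl
  have l2 := integral_iSup_signed_dev_le (P := P) (n := n) hs hψm hψC
  have l3 := radFam_comp_sub_le (P := P) (n := n) hαβ hr hgm hL hgL hu hub hDJ hDc hDn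
  linarith

omit [Countable ι] in
lemma shiftDev_le_add (h : TangentConvex φ z₀ r M) (hr : r = β - α) (hφ : Measurable φ)
    (hu : ∀ i, Measurable (u i)) (hub : ∀ i y, u i y ∈ Icc α β) (hs : s = 1 ∨ s = -1)
    {z : ℝ} (hz : z ∈ Icc (z₀ - r) z₀) {y y' : Fin n → Y} {j : Fin n}
    (hyy : ∀ k, k ≠ j → y' k = y k) :
    shiftDev φ (Icc (α - z₀) (β - z₀)) P u s y' ≤ shiftDev φ (Icc (α - z₀) (β - z₀)) P u s y +
      (-z + (((n : ℝ) - 1) / n) * φ z + (1 / (n : ℝ)) * φ (r + z)) := by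
  refine ciSup_le fun i => ?_
  have h1 := le_ciSup (bddAbove_of_abs_le
    fun i => h.abs_shiftInf_sub_le (μ := empMeas n y) (ν := P) hr hφ (hu i) (hub i) (hu i) (hub i)
      hs) i
  have h2 := h.shiftInf_empMeas_le hr hφ (hu i) (hub i) hyy hz
  have h3 := h.shiftInf_empMeas_le hr hφ (hu i) (hub i) (fun k hk => (hyy k hk).symm) hz
  unfold shiftDev
  rcases hs with rfl | rfl <;> linarith

end TangentConvex

end Deviation

section Tail

variable {X Z : Type*} [MeasurableSpace X] [MeasurableSpace Z]

lemma measureReal_ge_le_of_bounded_differences (Q : Measure X) [IsProbabilityMeasure Q]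
    (P : Measure Z) [IsProbabilityMeasure P] {n m : ℕ} {F : (Fin n → X) → ℝ} {G : (Fin m → Z) → ℝ}
    {C c d eF eG ε : ℝ} (hF : Measurable F) (hG : Measurable G) (hFC : ∀ x, |F x| ≤ C)
    (hGC : ∀ z, |G z| ≤ C) (hc : 0 ≤ c) (hd : 0 ≤ d)
    (hFc : ∀ x x' j, (∀ k, k ≠ j → x' k = x k) → F x' ≤ F x + c)
    (hGd : ∀ z z' j, (∀ k, k ≠ j → z' k = z k) → G z' ≤ G z + d)
    (heF : ∫ x, F x ∂(Measure.pi fun _ : Fin n => Q) ≤ eF)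
    (heG : ∫ z, G z ∂(Measure.pi fun _ : Fin m => P) ≤ eG) (hε : 0 ≤ ε) :
    ((Measure.pi fun _ : Fin n => Q).prod (Measure.pi fun _ : Fin m => P)).real
        {p | ε + eF + eG ≤ F p.1 + G p.2} ≤
      Real.exp (-ε ^ 2 / (2 * (n * (c / 2) ^ 2 + m * (d / 2) ^ 2))) := by
  lift c to ℝ≥0 using hc
  lift d to ℝ≥0 using hd
  set μ := Measure.pi fun _ : Fin n => Q
  set ν := Measure.pi fun _ : Fin m => P
  have h1 := hasSubgaussianMGF_of_bounded_differences Q c n hF hFC hFc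
  have h2 := hasSubgaussianMGF_of_bounded_differences P d m hG hGC hGd
  have h1' : HasSubgaussianMGF (fun p : (Fin n → X) × (Fin m → Z) => F p.1 - ∫ x, F x ∂μ)
      (n * (c / 2) ^ 2) (μ.prod ν) := by
    refine HasSubgaussianMGF.of_map (X := fun x => F x - ∫ x, F x ∂μ)
      measurable_fst.aemeasurable ?_
    rwa [measurePreserving_fst.map_eq]
  have h2' : HasSubgaussianMGF (fun p : (Fin n → X) × (Fin m → Z) => G p.2 - ∫ z, G z ∂ν)
      (m * (d / 2) ^ 2) (μ.prod ν) := by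
    refine HasSubgaussianMGF.of_map (X := fun z => G z - ∫ z, G z ∂ν)
      measurable_snd.aemeasurable ?_
    rwa [measurePreserving_snd.map_eq]
  have hind : ProbabilityTheory.IndepFun
      (fun p : (Fin n → X) × (Fin m → Z) => F p.1 - ∫ x, F x ∂μ)
      (fun p => G p.2 - ∫ z, G z ∂ν) (μ.prod ν) :=
    ProbabilityTheory.indepFun_prod (hF.sub_const _) (hG.sub_const _)
  have h3 := (h1'.add_of_indepFun h2' hind).measure_ge_le hε
  refine (measureReal_mono fun p hp => ?_).trans (h3.trans_eq (by push_cast; rfl))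
  simp only [mem_ofPred_eq] at hp ⊢
  linarith

end Tail

section DenseFamily

variable {Y : Type*} [MeasurableSpace Y] {ι : Type*} {α β : ℝ}

/-- Sequential continuity of a functional for pointwise convergence of measurable functions
with values in `[α, β]`. -/
def SeqContinuousOnIcc (α β : ℝ) (J : (Y → ℝ) → ℝ) : Prop :=
  ∀ (s : ℕ → Y → ℝ) (v : Y → ℝ), (∀ j, Measurable (s j)) → (∀ j y, s j y ∈ Icc α β) →
    Measurable v → (∀ y, v y ∈ Icc α β) → (∀ y, Tendsto (fun j => s j y) atTop (𝓝 (v y))) →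
    Tendsto (fun j => J (s j)) atTop (𝓝 (J v))

/-- The family `u` determines upper bounds over `Ψ` of sequentially continuous functionals. -/
structure DenseFamily (α β : ℝ) (Ψ : Set (Y → ℝ)) (u : ι → Y → ℝ) : Prop where
  measurable : ∀ ψ ∈ Ψ, Measurable ψ
  mem_Icc : ∀ ψ ∈ Ψ, ∀ y, ψ y ∈ Icc α β
  mem : ∀ i, u i ∈ Ψ
  le_of_forall : ∀ J : (Y → ℝ) → ℝ, SeqContinuousOnIcc α β J → ∀ B, (∀ i, J (u i) ≤ B) →
    ∀ ψ ∈ Ψ, J ψ ≤ B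

lemma seqContinuousOnIcc_integral (P : Measure Y) [IsProbabilityMeasure P] :
    SeqContinuousOnIcc α β fun u => ∫ y, u y ∂P := by
  intro s v hs hsb _ _ hlim
  refine tendsto_integral_of_dominated_convergence (fun _ => max |α| |β|)
    (fun j => (hs j).aestronglyMeasurable) (integrable_const _)
    (fun j => ae_of_all _ fun y => ?_) (ae_of_all _ hlim)
  exact abs_le_max_abs_abs (hsb j y).1 (hsb j y).2

variable {Ψ : Set (Y → ℝ)} {u : ι → Y → ℝ} [Nonempty ι]

omit [Nonempty ι] in
lemma DenseFamily.le_iSup (h : DenseFamily α β Ψ u) {J : (Y → ℝ) → ℝ}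
    (hJ : SeqContinuousOnIcc α β J) {C : ℝ} (hC : ∀ i, |J (u i)| ≤ C) {ψ : Y → ℝ} (hψ : ψ ∈ Ψ) :
    J ψ ≤ ⨆ i, J (u i) :=
  h.le_of_forall J hJ _ (fun i => le_ciSup (bddAbove_of_abs_le hC) i) ψ hψ

lemma DenseFamily.rad_eq (h : DenseFamily α β Ψ u) (P : Measure Y) (n : ℕ) :
    rad Ψ P n = radFam u P n := by
  refine integral_congr_ae (ae_of_all _ fun y => ?_)
  simp only [empRad, signSup]
  congr 1
  refine Finset.sum_congr rfl fun σ _ => ?_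
  change sSup {r : ℝ | ∃ ψ ∈ Ψ, r = (n : ℝ)⁻¹ * ∑ i, boolSign (σ i) * ψ (y i)} = _
  have hb : ∀ ψ ∈ Ψ, |(n : ℝ)⁻¹ * ∑ i, boolSign (σ i) * ψ (y i)| ≤ max |α| |β| :=
    fun ψ hψ => abs_signed_mean_le ((abs_nonneg _).trans (le_max_left _ _)) σ fun k =>
      abs_le_max_abs_abs (h.mem_Icc ψ hψ _).1 (h.mem_Icc ψ hψ _).2
  refine le_antisymm (csSup_le ⟨_, u (Classical.arbitrary ι), h.mem _, rfl⟩ ?_) (ciSup_le fun i => ?_)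
  · rintro _ ⟨ψ, hψ, rfl⟩
    refine h.le_iSup (J := fun ψ => (n : ℝ)⁻¹ * ∑ i, boolSign (σ i) * ψ (y i))
      (fun s v _ _ _ _ hlim => ?_) (fun i => hb _ (h.mem i)) hψ
    exact (tendsto_finsetSum _ fun k _ => (hlim (y k)).const_mul _).const_mul _
  · refine le_csSup ⟨max |α| |β|, ?_⟩ ⟨u i, h.mem i, rfl⟩
    rintro _ ⟨ψ, hψ, rfl⟩
    exact (abs_le.1 (hb ψ hψ)).2

end DenseFamily

section Composition

variable {X : Type*} [TopologicalSpace X] [MeasurableSpace X] [BorelSpace X]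
  {Z : Type*} [MeasurableSpace Z] {Θ : Type*} [PseudoMetricSpace Θ]
  [TopologicalSpace.SeparableSpace Θ] [Nonempty Θ] {α β : ℝ} {Γ : Set (X → ℝ)} {Φ : Θ → Z → X}

lemma exists_denseFamily_comp (hne : Γ.Nonempty) (hcont : ∀ h ∈ Γ, Continuous h)
    (hbd : ∀ h ∈ Γ, ∀ x, h x ∈ Icc α β) (hd : PtwiseDenseCount Γ) (hΦm : ∀ θ, Measurable (Φ θ))
    (hΦc : ∀ z, Continuous fun θ => Φ θ z) :
    ∃ (Γ₀ : Set (X → ℝ)) (_ : Countable Γ₀) (_ : Nonempty Γ₀) (u : Γ₀ × ℕ → Z → ℝ),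
      DenseFamily α β {g : Z → ℝ | ∃ h ∈ Γ, ∃ θ : Θ, g = fun z => h (Φ θ z)} u := by
  obtain ⟨Γ₀, hsub, hc, hlim⟩ := hd
  have hm (h : X → ℝ) (hh : h ∈ Γ) (θ : Θ) : Measurable fun z => h (Φ θ z) :=
    (hcont h hh).measurable.comp (hΦm θ)
  have hΓ₀ : Γ₀.Nonempty := by
    obtain ⟨h, hh⟩ := hne
    obtain ⟨s, hs, -⟩ := hlim h hh
    exact ⟨s 0, hs 0⟩
  refine ⟨Γ₀, hc.to_subtype, hΓ₀.to_subtype,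
    fun p z => p.1.1 (Φ (TopologicalSpace.denseSeq Θ p.2) z), ?_, ?_, ?_, ?_⟩
  · rintro _ ⟨h, hh, θ, rfl⟩; exact hm h hh θ
  · rintro _ ⟨h, hh, θ, rfl⟩ z; exact hbd h hh _
  · exact fun p => ⟨p.1, hsub p.1.2, _, rfl⟩
  · rintro J hJ B hB _ ⟨h, hh, θ, rfl⟩
    have h1 : ∀ g ∈ Γ₀, ∀ θ, J (fun z => g (Φ θ z)) ≤ B := by
      intro g hg θ
      obtain ⟨x, hx, hxθ⟩ := mem_closure_iff_seq_limit.1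
        ((TopologicalSpace.denseRange_denseSeq Θ) θ)
      choose k hk using hx
      refine le_of_tendsto (hJ (fun j z => g (Φ (x j) z)) _ (fun j => hm g (hsub hg) _)
        (fun j z => hbd g (hsub hg) _) (hm g (hsub hg) θ) (fun z => hbd g (hsub hg) _) fun z => ?_)
        (Eventually.of_forall fun j => ?_)
      · exact (((hcont g (hsub hg)).comp (hΦc z)).tendsto θ).comp hxθ
      · rw [← hk j]; exact hB (⟨g, hg⟩, k j)
    obtain ⟨s, hs, hsl⟩ := hlim h hh
    exact le_of_tendsto (hJ (fun j z => s j (Φ θ z)) _ (fun j => hm _ (hsub (hs j)) _)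
      (fun j z => hbd _ (hsub (hs j)) _) (hm h hh θ) (fun z => hbd h hh _) fun z => hsl _)
      (Eventually.of_forall fun j => h1 _ (hs j) θ)

lemma exists_denseFamily (hne : Γ.Nonempty) (hcont : ∀ h ∈ Γ, Continuous h)
    (hbd : ∀ h ∈ Γ, ∀ x, h x ∈ Icc α β) (hd : PtwiseDenseCount Γ) :
    ∃ (Γ₀ : Set (X → ℝ)) (_ : Countable Γ₀) (_ : Nonempty Γ₀) (u : Γ₀ × ℕ → X → ℝ),
      DenseFamily α β Γ u := by
  simpa using exists_denseFamily_comp (Φ := fun (_ : Unit) (x : X) => x) hne hcont hbd hd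
    (fun _ => measurable_id) fun _ => continuous_const

end Composition

section Divergence

variable {X : Type*} [MeasurableSpace X] {f : ℝ → ℝ} {a : ℝ} {b : EReal}

lemma le_Dfg {Γ : Set (X → ℝ)} {Q P : Measure X} {C : ℝ}
    (hC : ∀ h ∈ Γ, |∫ x, h x ∂Q - cgfR f a b P h| ≤ C) {h : X → ℝ} (hh : h ∈ Γ) :
    ∫ x, h x ∂Q - cgfR f a b P h ≤ Dfg f a b Γ Q P :=
  le_csSup ⟨C, by rintro _ ⟨g, hg, rfl⟩; exact (abs_le.1 (hC g hg)).2⟩ ⟨h, hh, rfl⟩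

lemma Dfg_le {Γ : Set (X → ℝ)} {Q P : Measure X} {B : ℝ} (hne : Γ.Nonempty)
    (hB : ∀ h ∈ Γ, ∫ x, h x ∂Q - cgfR f a b P h ≤ B) : Dfg f a b Γ Q P ≤ B := by
  obtain ⟨h, hh⟩ := hne
  refine csSup_le ⟨_, h, hh, rfl⟩ ?_
  rintro _ ⟨g, hg, rfl⟩
  exact hB g hg

lemma Dfg_sub_iInf_le {Θ : Type*} [Nonempty Θ] {Γ Γt : Set (X → ℝ)} (hsub : Γt ⊆ Γ)
    (hne : Γt.Nonempty) {Q Qn : Measure X} {p pn : Θ → Measure X} {C A₁ A₂ B₁ B₂ e e' : ℝ}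
    (hC : ∀ θ, ∀ h ∈ Γ, |∫ x, h x ∂Q - cgfR f a b (p θ) h| ≤ C)
    (hCn : ∀ θ, ∀ h ∈ Γt, |∫ x, h x ∂Qn - cgfR f a b (pn θ) h| ≤ C)
    (happrox : ∀ θ, Dfg f a b Γ Q (p θ) ≤ Dfg f a b Γt Q (p θ) + e)
    (hA₁ : ∀ h ∈ Γt, ∫ x, h x ∂Qn - ∫ x, h x ∂Q ≤ A₁)
    (hA₂ : ∀ h ∈ Γt, ∫ x, h x ∂Q - ∫ x, h x ∂Qn ≤ A₂)
    (hB₁ : ∀ θ, ∀ h ∈ Γt, cgfR f a b (pn θ) h - cgfR f a b (p θ) h ≤ B₁)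
    (hB₂ : ∀ θ, ∀ h ∈ Γt, cgfR f a b (p θ) h - cgfR f a b (pn θ) h ≤ B₂) {θs : Θ}
    (hopt : Dfg f a b Γt Qn (pn θs) ≤ (⨅ θ, Dfg f a b Γt Qn (pn θ)) + e') :
    Dfg f a b Γ Q (p θs) - ⨅ θ, Dfg f a b Γ Q (p θ) ≤ e + e' + (A₁ + A₂) + (B₁ + B₂) := by
  rw [sub_le_comm]
  refine le_ciInf fun θ => ?_
  have h1 : Dfg f a b Γt Q (p θs) ≤ Dfg f a b Γt Qn (pn θs) + A₂ + B₁ :=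
    Dfg_le hne fun h hh => by linarith [le_Dfg (hCn θs) hh, hA₂ h hh, hB₁ θs h hh]
  have h2 : Dfg f a b Γt Qn (pn θ) ≤ Dfg f a b Γ Q (p θ) + A₁ + B₂ :=
    Dfg_le hne fun h hh => by linarith [le_Dfg (hC θ) (hsub hh), hA₁ h hh, hB₂ θ h hh]
  have h3 : ⨅ θ, Dfg f a b Γt Qn (pn θ) ≤ Dfg f a b Γt Qn (pn θ) := by
    refine ciInf_le ⟨-C, ?_⟩ θ
    rintro _ ⟨θ', rfl⟩
    obtain ⟨h, hh⟩ := hne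
    exact (abs_le.1 (hCn θ' h hh)).1.trans (le_Dfg (hCn θ') hh)
  linarith [happrox θs]

lemma Dfg_le_add_approxErr [Nonempty X] {Γ Γt : Set (X → ℝ)} (hne : Γt.Nonempty) (hsub : Γt ⊆ Γ)
    {α β M C : ℝ} (hM : 0 ≤ M) (hbd : ∀ h ∈ Γ, ∀ x, h x ∈ Icc α β) {Q P : Measure X}
    [IsProbabilityMeasure Q] (hm : ∀ h ∈ Γ, Measurable h)
    (hC : ∀ h ∈ Γ, |∫ x, h x ∂Q - cgfR f a b P h| ≤ C)
    (hlip : ∀ h ∈ Γ, ∀ g ∈ Γ, ∀ t, (∀ x, |h x - g x| ≤ t) →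
      cgfR f a b P h ≤ cgfR f a b P g + M * t) :
    Dfg f a b Γ Q P ≤ Dfg f a b Γt Q P + (1 + M) * approxErr Γ Γt := by
  have hdist : ∀ h ∈ Γ, ∀ g ∈ Γ, ∀ x, |h x - g x| ≤ β - α := fun h hh g hg x =>
    abs_le.2 ⟨by linarith [(hbd h hh x).1, (hbd g hg x).2],
      by linarith [(hbd h hh x).2, (hbd g hg x).1]⟩
  refine Dfg_le (hne.mono hsub) fun h hh => ?_
  have hle : sInf {s : ℝ | ∃ ht ∈ Γt, s = ⨆ x, |h x - ht x|} ≤ approxErr Γ Γt := by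
    refine le_csSup ⟨β - α, ?_⟩ ⟨h, hh, rfl⟩
    rintro _ ⟨g, hg, rfl⟩
    obtain ⟨ht, hht⟩ := hne
    have hbelow : BddBelow {s : ℝ | ∃ ht ∈ Γt, s = ⨆ x, |g x - ht x|} :=
      ⟨0, by rintro _ ⟨k, -, rfl⟩; exact Real.iSup_nonneg fun x => abs_nonneg _⟩
    exact (csInf_le hbelow ⟨ht, hht, rfl⟩).trans (ciSup_le (hdist g hg ht (hsub hht)))
  have hM1 : 0 < 1 + M := by linarith
  suffices H : (∫ x, h x ∂Q - cgfR f a b P h - Dfg f a b Γt Q P) / (1 + M) ≤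
      sInf {s : ℝ | ∃ ht ∈ Γt, s = ⨆ x, |h x - ht x|} by
    have := (div_le_iff₀' hM1).1 (H.trans hle)
    linarith
  obtain ⟨ht₀, hht₀⟩ := hne
  refine le_csInf ⟨_, ht₀, hht₀, rfl⟩ ?_
  rintro _ ⟨ht, hht, rfl⟩
  have hs (x : X) : |h x - ht x| ≤ ⨆ x, |h x - ht x| :=
    le_ciSup (f := fun x => |h x - ht x|)
      ⟨β - α, by rintro _ ⟨x, rfl⟩; exact hdist h hh ht (hsub hht) x⟩ x
  have h1 := hlip ht (hsub hht) h hh _ fun x => by rw [abs_sub_comm]; exact hs x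
  have h2 : ∫ x, h x ∂Q ≤ ∫ x, ht x ∂Q + ⨆ x, |h x - ht x| := by
    have i1 : Integrable h Q :=
      Integrable.of_mem_Icc α β (hm h hh).aemeasurable (ae_of_all _ (hbd h hh))
    have i2 : Integrable ht Q := Integrable.of_mem_Icc α β (hm ht (hsub hht)).aemeasurable
      (ae_of_all _ (hbd ht (hsub hht)))
    have := integral_mono i1 (i2.add (integrable_const (⨆ x, |h x - ht x|))) fun x => by
      have := (le_abs_self _).trans (hs x)
      simp only [Pi.add_apply]
      linarith
    rw [integral_add' i2 (integrable_const _)] at this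
    simpa using this
  have h3 := le_Dfg (fun g hg => hC g (hsub hg)) hht
  rw [div_le_iff₀' hM1]
  linarith

end Divergence

section MeanDev

variable {Y : Type*} [MeasurableSpace Y] {P : Measure Y} {ι : Type*} {n : ℕ} {s α β : ℝ}
  {u : ι → Y → ℝ}

/-- Uniform deviation of the mean between a measure and its empirical version. -/
noncomputable def meanDev (P : Measure Y) (u : ι → Y → ℝ) (s : ℝ) (y : Fin n → Y) : ℝ :=
  ⨆ i, s * (∫ x, u i x ∂(empMeas n y) - ∫ x, u i x ∂P)

lemma integral_mem_Icc [IsProbabilityMeasure P] {v : Y → ℝ} (hv : Measurable v)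
    (hvb : ∀ y, v y ∈ Icc α β) : ∫ y, v y ∂P ∈ Icc α β := by
  have hi : Integrable v P := Integrable.of_mem_Icc α β hv.aemeasurable (ae_of_all _ hvb)
  have h1 := integral_mono (integrable_const α) hi fun y => (hvb y).1
  have h2 := integral_mono hi (integrable_const β) fun y => (hvb y).2
  simp only [integral_const, probReal_univ, one_smul] at h1 h2
  exact ⟨h1, h2⟩

variable [IsProbabilityMeasure P] [NeZero n]

lemma abs_mean_sub_le (hs : s = 1 ∨ s = -1) {v : Y → ℝ} (hv : Measurable v)
    (hvb : ∀ y, v y ∈ Icc α β) (y : Fin n → Y) :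
    |s * (∫ x, v x ∂(empMeas n y) - ∫ x, v x ∂P)| ≤ β - α := by
  have : |s| = 1 := by rcases hs with rfl | rfl <;> simp
  rw [abs_mul, this, one_mul]
  have h1 := integral_mem_Icc (P := empMeas n y) hv hvb
  have h2 := integral_mem_Icc (P := P) hv hvb
  exact abs_le.2 ⟨by linarith [h1.1, h2.2], by linarith [h1.2, h2.1]⟩

omit [IsProbabilityMeasure P] [NeZero n] in
lemma measurable_meanDev [Countable ι] (hu : ∀ i, Measurable (u i)) :
    Measurable (meanDev (n := n) P u s) := by
  refine Measurable.iSup fun i => Measurable.const_mul (Measurable.sub_const ?_ _) s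
  rw [funext fun y : Fin n → Y => integral_empMeas y (hu i)]
  have := hu i
  fun_prop

variable [Nonempty ι]

lemma abs_meanDev_le (hs : s = 1 ∨ s = -1) (hu : ∀ i, Measurable (u i))
    (hub : ∀ i y, u i y ∈ Icc α β) (y : Fin n → Y) : |meanDev P u s y| ≤ β - α :=
  abs_iSup_le fun i => abs_mean_sub_le hs (hu i) (hub i) y

lemma meanDev_le_add (hs : s = 1 ∨ s = -1) (hu : ∀ i, Measurable (u i))
    (hub : ∀ i y, u i y ∈ Icc α β) {y y' : Fin n → Y} {j : Fin n}
    (hyy : ∀ k, k ≠ j → y' k = y k) :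
    meanDev P u s y' ≤ meanDev P u s y + (β - α) / n := by
  have hn : (0 : ℝ) < n := by exact_mod_cast NeZero.pos n
  refine ciSup_le fun i => ?_
  have h1 : _ ≤ meanDev P u s y := le_ciSup (bddAbove_of_abs_le
    fun i => abs_mean_sub_le (P := P) hs (hu i) (hub i) y) i
  have h2 : ∫ x, u i x ∂(empMeas n y') - ∫ x, u i x ∂(empMeas n y) =
      (u i (y' j) - u i (y j)) / n := by
    rw [integral_empMeas y' (hu i), integral_empMeas y (hu i), ← mul_sub, ← Finset.sum_sub_distrib,
      Finset.sum_eq_single j (fun k _ hk => by rw [hyy k hk, sub_self]) (by simp), inv_mul_eq_div]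
  have h3 : |s * ((u i (y' j) - u i (y j)) / n)| ≤ (β - α) / n := by
    have : |s| = 1 := by rcases hs with rfl | rfl <;> simp
    rw [abs_mul, this, one_mul, abs_div, abs_of_pos hn]
    gcongr
    exact abs_le.2 ⟨by linarith [(hub i (y' j)).1, (hub i (y j)).2],
      by linarith [(hub i (y' j)).2, (hub i (y j)).1]⟩
  have h4 := (le_abs_self _).trans h3
  rw [← h2] at h4
  linarith

end MeanDev

section DenseDeviation

variable {Y : Type*} [MeasurableSpace Y] {P : Measure Y} [IsProbabilityMeasure P] {ι : Type*}
  {n : ℕ} [NeZero n] {s α β : ℝ} {Ψ : Set (Y → ℝ)} {u : ι → Y → ℝ}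

lemma DenseFamily.le_meanDev (h : DenseFamily α β Ψ u) (hs : s = 1 ∨ s = -1) {ψ : Y → ℝ}
    (hψ : ψ ∈ Ψ) (y : Fin n → Y) :
    s * (∫ x, ψ x ∂(empMeas n y) - ∫ x, ψ x ∂P) ≤ meanDev P u s y :=
  h.le_iSup (J := fun ψ => s * (∫ x, ψ x ∂(empMeas n y) - ∫ x, ψ x ∂P))
    (fun _ _ h1 h2 h3 h4 h5 => ((seqContinuousOnIcc_integral _ _ _ h1 h2 h3 h4 h5).sub
      (seqContinuousOnIcc_integral _ _ _ h1 h2 h3 h4 h5)).const_mul s)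
    (fun i => abs_mean_sub_le hs (h.measurable _ (h.mem i)) (h.mem_Icc _ (h.mem i)) y) hψ

lemma DenseFamily.le_shiftDev {φ : ℝ → ℝ} {z₀ r M : ℝ} (h : DenseFamily α β Ψ u)
    (hT : TangentConvex φ z₀ r M) (hr : r = β - α) (hφ : Measurable φ) (hs : s = 1 ∨ s = -1)
    {ψ : Y → ℝ} (hψ : ψ ∈ Ψ) (y : Fin n → Y) :
    s * (shiftInf φ (Icc (α - z₀) (β - z₀)) (empMeas n y) ψ -
      shiftInf φ (Icc (α - z₀) (β - z₀)) P ψ) ≤ shiftDev φ (Icc (α - z₀) (β - z₀)) P u s y :=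
  h.le_iSup (J := fun ψ => s * (shiftInf φ (Icc (α - z₀) (β - z₀)) (empMeas n y) ψ -
      shiftInf φ (Icc (α - z₀) (β - z₀)) P ψ))
    (fun _ _ h1 h2 h3 h4 h5 => ((hT.tendsto_shiftInf hr hφ h3 h4 h1 h2 h5).sub
      (hT.tendsto_shiftInf hr hφ h3 h4 h1 h2 h5)).const_mul s)
    (fun i => hT.abs_shiftInf_sub_le hr hφ (h.measurable _ (h.mem i)) (h.mem_Icc _ (h.mem i))
      (h.measurable _ (h.mem i)) (h.mem_Icc _ (h.mem i)) hs) hψ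

end DenseDeviation

lemma shiftInf_map {X Z : Type*} [MeasurableSpace X] [MeasurableSpace Z] {φ : ℝ → ℝ}
    (hφ : Measurable φ) {T : Z → X} (hT : Measurable T) (J : Set ℝ) (P : Measure Z) {h : X → ℝ}
    (hh : Measurable h) : shiftInf φ J (P.map T) h = shiftInf φ J P fun z => h (T z) := by
  refine iInf_congr fun ν => ?_
  rw [integral_map (f := fun x => φ (h x - ν)) hT.aemeasurable
    (hφ.comp (hh.sub_const _)).aestronglyMeasurable]

section Constants

variable {f : ℝ → ℝ} {a : ℝ} {b : EReal} {α β : ℝ} {Y : Type*} [MeasurableSpace Y]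
  {P : Measure Y} [IsProbabilityMeasure P] {ι : Type*} [Nonempty ι] [Countable ι]
  {n : ℕ} [NeZero n] {s : ℝ} {u : ι → Y → ℝ}

lemma TangentConvex.Δq_nonneg {M : ℝ} (h : TangentConvex (fStarR f a b) (zz f) (β - α) M)
    (n : ℕ) [NeZero n] : 0 ≤ Δq f a b α β n := by
  have hn : (0 : ℝ) < n := by exact_mod_cast NeZero.pos n
  have hn1 : (1 : ℝ) ≤ n := by exact_mod_cast NeZero.one_le
  have hr := h.pos
  refine Real.sInf_nonneg ?_
  rintro _ ⟨z, hz, rfl⟩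
  refine mul_nonneg hn.le ?_
  have h1 := mul_le_mul_of_nonneg_left (h.le z ⟨hz.1, by linarith [hz.2]⟩)
    (div_nonneg (sub_nonneg.2 hn1) hn.le)
  have h2 := mul_le_mul_of_nonneg_left
    (h.le (β - α + z) ⟨by linarith [hz.1], by linarith [hz.2]⟩) (one_div_pos.2 hn).le
  have h3 : 0 ≤ 1 / (n : ℝ) * (β - α) := by positivity
  have h4 : ((n : ℝ) - 1) / n * z = z - 1 / n * z := by field_simp
  linarith

omit [Countable ι] in
lemma TangentConvex.shiftDev_le_add_Δq {M : ℝ}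
    (h : TangentConvex (fStarR f a b) (zz f) (β - α) M) (hφ : Measurable (fStarR f a b))
    (hu : ∀ i, Measurable (u i)) (hub : ∀ i y, u i y ∈ Icc α β) (hs : s = 1 ∨ s = -1)
    {y y' : Fin n → Y} {j : Fin n} (hyy : ∀ k, k ≠ j → y' k = y k) :
    shiftDev (fStarR f a b) (Icc (α - zz f) (β - zz f)) P u s y' ≤
      shiftDev (fStarR f a b) (Icc (α - zz f) (β - zz f)) P u s y + Δq f a b α β n / n := by
  have hn : (0 : ℝ) < n := by exact_mod_cast NeZero.pos n
  rw [← sub_le_iff_le_add', le_div_iff₀' hn]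
  refine le_csInf ((Set.nonempty_Icc.2 (by linarith [h.pos])).image _) ?_
  rintro _ ⟨z, hz, rfl⟩
  exact mul_le_mul_of_nonneg_left
    (sub_le_iff_le_add'.2 (h.shiftDev_le_add rfl hφ hu hub hs hz hyy)) hn.le

lemma DenseFamily.integral_shiftDev_le_Kchoice {Ψ : Set (Y → ℝ)} (hD : DenseFamily α β Ψ u)
    (ha0 : 0 ≤ a) (h1 : (1 : ℝ) ∈ Dom a b) (hf1 : f 1 = 0) (hconv : ConvexOn ℝ (Dom a b) f)
    (hαβ : α < β) (hz : zz f + (β - α) ∈ interior {z : ℝ | fStar f a b z < ⊤}) {K : ℝ}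
    (hK : Kchoice f a b α β Ψ P n K) (hs : s = 1 ∨ s = -1) :
    ∫ y, shiftDev (n := n) (fStarR f a b) (Icc (α - zz f) (β - zz f)) P u s y
      ∂(Measure.pi fun _ : Fin n => P) ≤ 2 * K := by
  have hr := sub_pos.2 hαβ
  have hT := tangentConvex_fStarR ha0 h1 hf1 hconv hr hz
  have hφ := measurable_fStarR (f := f) (b := b) ha0
  have hu (i : ι) := hD.measurable _ (hD.mem i)
  have hub (i : ι) := hD.mem_Icc _ (hD.mem i)
  have hR : 0 ≤ radFam u P n := radFam_nonneg (C := max |α| |β|) (by positivity) fun i y =>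
    abs_le_max_abs_abs (hub i y).1 (hub i y).2
  have hlip := hT.integral_shiftDev_le (P := P) (n := n) rfl hφ hu hub hs le_rfl
    (zero_le_one.trans hT.one_le)
    (by simpa using hT.lip)
  rw [Kchoice, hD.rad_eq, add_comm (β - α)] at hK
  rw [zero_mul, zero_add] at hlip
  rcases hK with ⟨L, hL, -, rfl⟩ | rfl
  · rw [mul_min_of_nonneg _ _ zero_le_two]
    refine le_min ?_ hlip
    refine (hT.integral_shiftDev_le (P := P) (n := n) rfl hφ hu hub hs zero_le_one
      (L := L * (β - α)) (by positivity) fun x hx y hy => ?_).trans ?_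
    · simpa using fStarR_sub_id_lipschitz ha0 h1 hf1 hconv hr hz hL hx hy
    · have : 0 ≤ L * (β - α) * radFam u P n := by positivity
      have e : L * (β - α) * ((β - α) / (2 * √n)) = (β - α) ^ 2 * L / (2 * √n) := by ring
      rw [mul_add (_ * (β - α)), e]
      linarith
  · exact hlip

end Constants

/-- The excess divergence of an approximate minimizer is controlled by the uniform deviations of
the two empirical measures. -/
lemma excess_Dfg_le {X Z Θ : Type*} [MeasurableSpace X] [MeasurableSpace Z] [Nonempty Θ]
    {f : ℝ → ℝ} {a : ℝ} {b : EReal} {α β : ℝ} (ha0 : 0 ≤ a) (h1 : (1 : ℝ) ∈ Dom a b)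
    (hf1 : f 1 = 0) (hconv : ConvexOn ℝ (Dom a b) f) (hαβ : α < β)
    (hz : zz f + (β - α) ∈ interior {z : ℝ | fStar f a b z < ⊤}) {Γ Γt : Set (X → ℝ)}
    (hsub : Γt ⊆ Γ) (hne : Γt.Nonempty) (hm : ∀ h ∈ Γ, Measurable h)
    (hbd : ∀ h ∈ Γ, ∀ x, h x ∈ Icc α β) {P : Measure Z} [IsProbabilityMeasure P]
    {Q : Measure X} [IsProbabilityMeasure Q] {Φ : Θ → Z → X} (hΦm : ∀ θ, Measurable (Φ θ))
    {ι κ : Type*} [Nonempty ι] [Nonempty κ] {u : ι → X → ℝ} {v : κ → Z → ℝ}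
    (hu : DenseFamily α β Γt u)
    (hv : DenseFamily α β {g : Z → ℝ | ∃ h ∈ Γt, ∃ θ : Θ, g = fun z => h (Φ θ z)} v)
    {n m : ℕ} [NeZero n] [NeZero m] (x : Fin n → X) (z : Fin m → Z) {θs : Θ} {e : ℝ}
    (hopt : Dfg f a b Γt (empMeas n x) ((empMeas m z).map (Φ θs)) ≤
      (⨅ θ : Θ, Dfg f a b Γt (empMeas n x) ((empMeas m z).map (Φ θ))) + e) :
    Dfg f a b Γ Q (P.map (Φ θs)) - ⨅ θ : Θ, Dfg f a b Γ Q (P.map (Φ θ)) ≤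
      (1 + rderiv (fStarR f a b) (zz f + (β - α))) * approxErr Γ Γt + e +
      (meanDev Q u 1 x + meanDev Q u (-1) x) +
      (shiftDev (fStarR f a b) (Icc (α - zz f) (β - zz f)) P v 1 z +
        shiftDev (fStarR f a b) (Icc (α - zz f) (β - zz f)) P v (-1) z) := by
  have : Nonempty X := nonempty_of_isProbabilityMeasure Q
  have hT := tangentConvex_fStarR ha0 h1 hf1 hconv (sub_pos.2 hαβ) hz
  have hφ := measurable_fStarR (f := f) (b := b) ha0
  have hmap (μ : Measure Z) [IsProbabilityMeasure μ] (θ : Θ) : IsProbabilityMeasure (μ.map (Φ θ)) :=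
    Measure.isProbabilityMeasure_map (hΦm θ).aemeasurable
  have hcgf (μ : Measure X) [IsProbabilityMeasure μ] {h : X → ℝ} (hh : h ∈ Γ) :
      cgfR f a b μ h = shiftInf (fStarR f a b) (Icc (α - zz f) (β - zz f)) μ h :=
    cgfR_eq_shiftInf ha0 h1 hf1 hconv hαβ hz (hm h hh) (hbd h hh)
  have hcgf' (μ : Measure Z) [IsProbabilityMeasure μ] (θ : Θ) {h : X → ℝ} (hh : h ∈ Γ) :
      cgfR f a b (μ.map (Φ θ)) h =
        shiftInf (fStarR f a b) (Icc (α - zz f) (β - zz f)) μ fun z => h (Φ θ z) := by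
    have := hmap μ θ
    rw [hcgf _ hh, shiftInf_map hφ (hΦm θ) _ _ (hm h hh)]
  have hC (μ ν : Measure X) [IsProbabilityMeasure μ] [IsProbabilityMeasure ν] {h : X → ℝ}
      (hh : h ∈ Γ) : |∫ x, h x ∂μ - cgfR f a b ν h| ≤ β - α := by
    have h1 := integral_mem_Icc (P := μ) (hm h hh) (hbd h hh)
    have h2 := hT.shiftInf_mem (P := ν) rfl hφ (hm h hh) (hbd h hh)
    rw [hcgf ν hh]
    exact abs_le.2 ⟨by linarith [h1.1, h2.2], by linarith [h1.2, h2.1]⟩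
  refine Dfg_sub_iInf_le (p := fun θ => P.map (Φ θ)) (pn := fun θ => (empMeas m z).map (Φ θ))
    (Qn := empMeas n x) (C := β - α) hsub hne (fun θ h hh => hC _ _ hh)
    (fun θ h hh => hC _ _ (hsub hh)) (fun θ => ?_) (fun h hh => ?_) (fun h hh => ?_)
    (fun θ h hh => ?_) (fun θ h hh => ?_) hopt
  · refine Dfg_le_add_approxErr hne hsub (zero_le_one.trans hT.one_le) hbd hm
      (C := β - α) (fun h hh => hC _ _ hh) fun h hh g hg t ht => ?_
    rw [hcgf _ hh, hcgf _ hg]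
    refine (hT.shiftInf_le_add rfl hφ (hm h hh) (hbd h hh) (hm g hg) (hbd g hg)).trans ?_
    gcongr
    · exact zero_le_one.trans hT.one_le
    · have hi : Integrable (fun x => |h x - g x|) (P.map (Φ θ)) :=
        Integrable.of_mem_Icc 0 t ((hm h hh).sub (hm g hg)).abs.aemeasurable
          (ae_of_all _ fun x => ⟨abs_nonneg _, ht x⟩)
      simpa using integral_mono hi (integrable_const t) ht
  · simpa using hu.le_meanDev (P := Q) (s := 1) (.inl rfl) hh x
  · simpa using hu.le_meanDev (P := Q) (s := -1) (.inr rfl) hh x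
  · rw [hcgf' _ θ (hsub hh), hcgf' _ θ (hsub hh)]
    simpa using hv.le_shiftDev (P := P) (s := 1) hT rfl hφ (.inl rfl) ⟨h, hh, θ, rfl⟩ z
  · rw [hcgf' _ θ (hsub hh), hcgf' _ θ (hsub hh)]
    simpa using hv.le_shiftDev (P := P) (s := -1) hT rfl hφ (.inr rfl) ⟨h, hh, θ, rfl⟩ z
open MeasureTheory in
/-- `(f,Γ)`-GAN concentration inequality. -/
theorem stmt11
    {X : Type*} [TopologicalSpace X] [MeasurableSpace X] [BorelSpace X]
    (f : ℝ → ℝ) (a : ℝ) (b : EReal) (α β : ℝ)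
    (ha0 : 0 ≤ a) (ha1 : a < 1) (hb1 : ((1 : ℝ) : EReal) < b)
    (hconv : ConvexOn ℝ (Dom a b) f) (hf1 : f 1 = 0)
    (hstrict : ∃ ε > 0, Set.Ioo (1 - ε) (1 + ε) ⊆ Dom a b ∧
      StrictConvexOn ℝ (Set.Ioo (1 - ε) (1 + ε)) f)
    (hz : zz f + β - α ∈ interior {z : ℝ | fStar f a b z < ⊤})
    (hαβ : α < β)
    (Γt Γ : Set (X → ℝ)) (hsub : Γt ⊆ Γ) (hΓtne : Γt.Nonempty)
    (hcont : ∀ h ∈ Γ, Continuous h) (hbd : ∀ h ∈ Γ, ∀ x, h x ∈ Set.Icc α β)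
    (hΓd : PtwiseDenseCount Γ) (hΓtd : PtwiseDenseCount Γt)
    {Z : Type*} [MeasurableSpace Z] (PZ : Measure Z) [IsProbabilityMeasure PZ]
    {Θ : Type*} [MetricSpace Θ] [TopologicalSpace.SeparableSpace Θ] [Nonempty Θ]
    [MeasurableSpace Θ] [BorelSpace Θ]
    (Φ : Θ → Z → X) (hΦm : ∀ θ, Measurable (Φ θ)) (hΦc : ∀ z, Continuous fun θ => Φ θ z)
    (Q : Measure X) [IsProbabilityMeasure Q]
    {Ω : Type*} [MeasurableSpace Ω] (ℙ : Measure Ω) [IsProbabilityMeasure ℙ]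
    (n m : ℕ) (hn : 0 < n) (hm : 0 < m)
    (Xs : Fin n → Ω → X) (Zs : Fin m → Ω → Z)
    (hXm : ∀ i, Measurable (Xs i)) (hZm : ∀ j, Measurable (Zs j))
    (hlaw : Measure.map (fun ω => (fun i => Xs i ω, fun j => Zs j ω)) ℙ =
      (Measure.pi fun _ : Fin n => Q).prod (Measure.pi fun _ : Fin m => PZ))
    (θstar : Ω → Θ) (hθm : Measurable θstar)
    (εopt : ℝ) (hεopt : 0 ≤ εopt)
    (hopt : ∀ᵐ ω ∂ℙ,
      Dfg f a b Γt (empMeas n fun i => Xs i ω)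
          (Measure.map (Φ (θstar ω)) (empMeas m fun j => Zs j ω)) ≤
        (⨅ θ : Θ, Dfg f a b Γt (empMeas n fun i => Xs i ω)
          (Measure.map (Φ θ) (empMeas m fun j => Zs j ω))) + εopt)
    (K : ℝ)
    (hK : Kchoice f a b α β {g : Z → ℝ | ∃ h ∈ Γt, ∃ θ : Θ, g = fun z => h (Φ θ z)} PZ m K)
    (ε : ℝ) (hε : 0 < ε) :
    (ℙ {ω | Dfg f a b Γ Q (Measure.map (Φ (θstar ω)) PZ)
          - (⨅ θ : Θ, Dfg f a b Γ Q (Measure.map (Φ θ) PZ)) ≥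
        ε + (1 + rderiv (fStarR f a b) (zz f + β - α)) * approxErr Γ Γt
          + εopt + 4 * rad Γt Q n + 4 * K}).toReal ≤
      Real.exp (-(ε ^ 2) /
        ((2 / (n : ℝ)) * (β - α) ^ 2 + (2 / (m : ℝ)) * (Δq f a b α β m) ^ 2)) := by
  have : NeZero n := ⟨hn.ne'⟩
  have : NeZero m := ⟨hm.ne'⟩
  rw [add_sub_assoc] at hz ⊢
  have h1 := one_mem_Dom ha1 hb1
  have hr := sub_pos.2 hαβ
  have hT := tangentConvex_fStarR ha0 h1 hf1 hconv hr hz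
  have hφ := measurable_fStarR (f := f) (b := b) ha0
  obtain ⟨Γ₁, _, _, u, hDu⟩ := exists_denseFamily hΓtne (fun h hh => hcont h (hsub hh))
    (fun h hh => hbd h (hsub hh)) hΓtd
  obtain ⟨Γ₂, _, _, v, hDv⟩ := exists_denseFamily_comp hΓtne (fun h hh => hcont h (hsub hh))
    (fun h hh => hbd h (hsub hh)) hΓtd hΦm hΦc
  have hu i := hDu.measurable _ (hDu.mem i)
  have hub i := hDu.mem_Icc _ (hDu.mem i)
  have hv i := hDv.measurable _ (hDv.mem i)
  have hvb i := hDv.mem_Icc _ (hDv.mem i)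
  have huC i x : |u i x| ≤ max |α| |β| := abs_le_max_abs_abs (hub i x).1 (hub i x).2
  have s1 : (1 : ℝ) = 1 ∨ (1 : ℝ) = -1 := .inl rfl
  have s2 : (-1 : ℝ) = 1 ∨ (-1 : ℝ) = -1 := .inr rfl
  set G := shiftDev (n := m) (fStarR f a b) (Set.Icc (α - zz f) (β - zz f)) PZ v with hGdef
  set F := meanDev (n := n) Q u with hFdef
  have hFm s : Measurable (F s) := measurable_meanDev hu
  have hGm s : Measurable (G s) := hT.measurable_shiftDev rfl hφ hv hvb s
  have hFC {s : ℝ} (hs : s = 1 ∨ s = -1) x : |F s x| ≤ β - α := abs_meanDev_le hs hu hub x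
  have hGC {s : ℝ} (hs : s = 1 ∨ s = -1) z : |G s z| ≤ β - α :=
    hT.abs_shiftDev_le rfl hφ hv hvb hs z
  have hFi {s : ℝ} (hs : s = 1 ∨ s = -1) : Integrable (F s) (Measure.pi fun _ : Fin n => Q) :=
    Integrable.of_bound (hFm s).aestronglyMeasurable _ (ae_of_all _ (hFC hs))
  have hGi {s : ℝ} (hs : s = 1 ∨ s = -1) : Integrable (G s) (Measure.pi fun _ : Fin m => PZ) :=
    Integrable.of_bound (hGm s).aestronglyMeasurable _ (ae_of_all _ (hGC hs))
  have hFE {s : ℝ} (hs : s = 1 ∨ s = -1) :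
      ∫ x, F s x ∂(Measure.pi fun _ : Fin n => Q) ≤ 2 * rad Γt Q n := by
    rw [hDu.rad_eq]
    exact integral_iSup_signed_dev_le hs hu huC
  have hGE {s : ℝ} (hs : s = 1 ∨ s = -1) :
      ∫ z, G s z ∂(Measure.pi fun _ : Fin m => PZ) ≤ 2 * K :=
    hDv.integral_shiftDev_le_Kchoice ha0 h1 hf1 hconv hαβ hz hK hs
  have key := measureReal_ge_le_of_bounded_differences Q PZ (F := fun x => F 1 x + F (-1) x)
    (G := fun z => G 1 z + G (-1) z) (C := 2 * (β - α)) (c := 2 * ((β - α) / n))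
    (d := 2 * (Δq f a b α β m / m)) (eF := 4 * rad Γt Q n) (eG := 4 * K)
    ((hFm 1).add (hFm (-1))) ((hGm 1).add (hGm (-1)))
    (fun x => (abs_add_le _ _).trans (by linarith [hFC s1 x, hFC s2 x]))
    (fun z => (abs_add_le _ _).trans (by linarith [hGC s1 z, hGC s2 z]))
    (by positivity) (mul_nonneg zero_le_two (div_nonneg (hT.Δq_nonneg m) m.cast_nonneg))
    (fun x x' j hx => by
      linarith [meanDev_le_add (P := Q) s1 hu hub hx, meanDev_le_add (P := Q) s2 hu hub hx])
    (fun z z' j hzz => by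
      linarith [hT.shiftDev_le_add_Δq (P := PZ) hφ hv hvb s1 hzz,
        hT.shiftDev_le_add_Δq (P := PZ) hφ hv hvb s2 hzz])
    (by rw [integral_add (hFi s1) (hFi s2)]; linarith [hFE s1, hFE s2])
    (by rw [integral_add (hGi s1) (hGi s2)]; linarith [hGE s1, hGE s2]) hε.le
  have hden : 2 * (n * (2 * ((β - α) / n) / 2) ^ 2 + m * (2 * (Δq f a b α β m / m) / 2) ^ 2) =
      2 / (n : ℝ) * (β - α) ^ 2 + 2 / (m : ℝ) * Δq f a b α β m ^ 2 := by
    field_simp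
  rw [hden, ← hlaw, measureReal_def, Measure.map_apply (by fun_prop)
    (measurableSet_le (by fun_prop) (by fun_prop))] at key
  refine le_trans (ENNReal.toReal_mono (measure_ne_top _ _) (measure_mono_ae ?_)) key
  filter_upwards [hopt] with ω hω hbad
  have := excess_Dfg_le (P := PZ) (Q := Q) ha0 h1 hf1 hconv hαβ hz hsub hΓtne
    (fun h hh => (hcont h hh).measurable) hbd hΦm hDu hDv _ _ hω
  change (_ : ℝ) ≤ _ at hbad
  change (_ : ℝ) ≤ _
  linarith
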